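/- arXiv:2309.10866 — 3 statements merged into one kernel-verified Lean document; each statement's English description precedes it below -/
import Mathlib

section
/- If f(X) in F_q[X] is exceptional over F_q, then there exists a positive integer N such that f(X) is exceptional over F_{q^m} for every positive integer m with gcd(m, N) = 1. -/
/-- `f ∈ F[X]` is exceptional over `F` if the only polynomials in `F[X,Y]` dividing
`f(X) - f(Y)` that are irreducible over the algebraic closure of `F` are the scalar
multiples `c·(X - Y)` with `c ≠ 0`. -/
def IsExceptional (F : Type) [Field F] (f : Polynomial F) : Prop :=
  ∀ P : MvPolynomial (Fin 2) F,
    P ∣ (Polynomial.aeval (MvPolynomial.X 0) f - Polynomial.aeval (MvPolynomial.X 1) f) →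
    Irreducible (MvPolynomial.map (algebraMap F (AlgebraicClosure F)) P) →
    ∃ c : F, c ≠ 0 ∧ P = MvPolynomial.C c * (MvPolynomial.X 0 - MvPolynomial.X 1)

open MvPolynomial

/-- Divisibility of multivariate polynomials descends along field extensions. -/
theorem MvPolynomial.dvd_of_map_algebraMap_dvd {σ F E : Type*} [Field F] [Field E] [Algebra F E]
    {p g : MvPolynomial σ F}
    (h : map (algebraMap F E) p ∣ map (algebraMap F E) g) : p ∣ g := by
  classical
  obtain ⟨Q, hQ⟩ := h
  obtain ⟨r, hr⟩ := (Algebra.linearMap F E).exists_leftInverse_of_injective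
    (LinearMap.ker_eq_bot.2 (algebraMap F E).injective)
  have hr' (a : F) : r (algebraMap F E a) = a := LinearMap.congr_fun hr a
  refine ⟨∑ d ∈ Q.support, monomial d (r (coeff d Q)), ?_⟩
  have hc (e : σ →₀ ℕ) :
      coeff e (∑ d ∈ Q.support, monomial d (r (coeff d Q))) = r (coeff e Q) := by
    simp only [coeff_sum, coeff_monomial, Finset.sum_ite_eq']
    split_ifs with he
    · rfl
    · rw [notMem_support_iff.1 he, map_zero]
  ext n
  have hn := congrArg (fun R => r (coeff n R)) hQ
  simp only [coeff_map, hr', coeff_mul, map_sum, ← Algebra.smul_def, map_smul] at hn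
  simp only [hn, coeff_mul, hc, smul_eq_mul]

/-- An element of an extension `E` of `F` whose degree over `F` is coprime to `[E : F]`
lies in `F`. -/
theorem mem_range_algebraMap_of_natDegree_minpoly_coprime {F E : Type*} [Field F] [Field E]
    [Algebra F E] [FiniteDimensional F E] {x : E}
    (h : (Module.finrank F E).Coprime (minpoly F x).natDegree) : x ∈ (algebraMap F E).range :=
  minpoly.natDegree_eq_one_iff.1 <| Nat.eq_one_of_dvd_coprimes h
    (minpoly.degree_dvd (Algebra.IsIntegral.isIntegral x)) dvd_rfl

/-- The difference `f(X) - f(Y)` attached to an exceptional polynomial is nonzero. -/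
theorem IsExceptional.aeval_sub_aeval_ne_zero {F : Type} [Field F] {f : Polynomial F}
    (hf : IsExceptional F f) :
    Polynomial.aeval (X 0 : MvPolynomial (Fin 2) F) f - Polynomial.aeval (X 1) f ≠ 0 := by
  intro h0
  obtain ⟨c, -, h⟩ := hf (X 0) (h0 ▸ dvd_zero _) (by
    rw [map_X]
    exact (X_prime (R := AlgebraicClosure F)).irreducible)
  simpa using congrArg (eval fun _ => (1 : F)) h

theorem MvPolynomial.map_aeval_X_sub_aeval_X {σ R S : Type*} [CommRing R] [CommRing S]
    (φ : R →+* S) (f : Polynomial R) (i j : σ) :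
    map φ (Polynomial.aeval (X i) f - Polynomial.aeval (X j) f) =
      Polynomial.aeval (X i) (f.map φ) - Polynomial.aeval (X j) (f.map φ) := by
  simp only [map_sub, Polynomial.aeval_def, Polynomial.hom_eval₂, Polynomial.eval₂_map, map_X]
  congr 2 <;> · ext; simp

/-- The product of the degrees over `F` of the ratios of coefficients of the irreducible factors
of `g` over an algebraic closure of `F`. -/
noncomputable def MvPolynomial.coeffRatioDegree {σ F : Type} [Field F]
    (g : MvPolynomial σ (AlgebraicClosure F)) : ℕ :=
  open Classical in
  ∏ q ∈ (UniqueFactorizationMonoid.factors g).toFinset, ∏ a ∈ q.support, ∏ b ∈ q.support,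
    (minpoly F (coeff a q / coeff b q)).natDegree

theorem MvPolynomial.coeffRatioDegree_pos {σ F : Type} [Field F]
    (g : MvPolynomial σ (AlgebraicClosure F)) : 0 < coeffRatioDegree g :=
  Finset.prod_pos fun _ _ => Finset.prod_pos fun _ _ => Finset.prod_pos fun _ _ =>
    minpoly.natDegree_pos (Algebra.IsIntegral.isIntegral _)

theorem MvPolynomial.natDegree_minpoly_dvd_coeffRatioDegree {σ F : Type} [Field F]
    {g q : MvPolynomial σ (AlgebraicClosure F)} {a b : σ →₀ ℕ}
    (hq : q ∈ UniqueFactorizationMonoid.factors g) (ha : a ∈ q.support) (hb : b ∈ q.support) :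
    (minpoly F (coeff a q / coeff b q)).natDegree ∣ coeffRatioDegree g := by
  classical
  exact (Finset.dvd_prod_of_mem
      (fun b => (minpoly F (coeff a q / coeff b q)).natDegree) hb).trans <|
    (Finset.dvd_prod_of_mem
      (fun a => ∏ b ∈ q.support, (minpoly F (coeff a q / coeff b q)).natDegree) ha).trans <|
    Finset.dvd_prod_of_mem (fun q : MvPolynomial σ (AlgebraicClosure F) =>
      ∏ a ∈ q.support, ∏ b ∈ q.support, (minpoly F (coeff a q / coeff b q)).natDegree)
      (Multiset.mem_toFinset.2 hq)

/-- If `[E : F]` is coprime to `coeffRatioDegree g`, then a polynomial over `E` that becomes an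
irreducible factor of `g` is a scalar multiple of a polynomial over `F`. -/
theorem MvPolynomial.exists_eq_C_mul_map_of_coprime {σ F E : Type} [Field F] [Field E]
    [Algebra F E] [FiniteDimensional F E] (ι : E →ₐ[F] AlgebraicClosure F)
    {g : MvPolynomial σ (AlgebraicClosure F)} (hg : g ≠ 0)
    (h : (Module.finrank F E).Coprime (coeffRatioDegree g)) {P : MvPolynomial σ E}
    (hP : Irreducible (map (ι : E →+* AlgebraicClosure F) P))
    (hPg : map (ι : E →+* AlgebraicClosure F) P ∣ g) :
    ∃ e : E, e ≠ 0 ∧ ∃ P' : MvPolynomial σ F, P = C e * map (algebraMap F E) P' := by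
  classical
  obtain ⟨q, hq, u, hu⟩ := UniqueFactorizationMonoid.exists_mem_factors_of_dvd hg hP hPg
  obtain ⟨v, hv, huv⟩ := isUnit_iff_eq_C_of_isReduced.1 u.isUnit
  have hcoeff (d : σ →₀ ℕ) : coeff d q = ι (coeff d P) * v := by
    rw [← hu, huv, mul_comm, coeff_C_mul, coeff_map, RingHom.coe_coe, mul_comm]
  have hP0 : P ≠ 0 := by
    rintro rfl
    exact hP.ne_zero (map_zero _)
  obtain ⟨b, hb⟩ := ne_zero_iff.1 hP0
  have hmem (d : σ →₀ ℕ) : coeff d P / coeff b P ∈ (algebraMap F E).range := by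
    by_cases hd : coeff d P = 0
    · rw [hd, zero_div]
      exact zero_mem _
    have hsupp {c : σ →₀ ℕ} (hc : coeff c P ≠ 0) : c ∈ q.support := by
      rw [mem_support_iff, hcoeff]
      exact mul_ne_zero ((map_ne_zero ι).2 hc) hv.ne_zero
    have hratio : coeff d q / coeff b q = ι (coeff d P / coeff b P) := by
      rw [hcoeff, hcoeff, mul_div_mul_right _ _ hv.ne_zero, map_div₀]
    apply mem_range_algebraMap_of_natDegree_minpoly_coprime
    rw [← minpoly.algHom_eq ι ι.injective, ← hratio]
    exact h.coprime_dvd_right (natDegree_minpoly_dvd_coeffRatioDegree hq (hsupp hd) (hsupp hb))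
  choose r hr using hmem
  refine ⟨coeff b P, hb, ∑ d ∈ P.support, monomial d (r d), ?_⟩
  ext d
  simp only [map_sum, map_monomial, coeff_C_mul, coeff_sum, coeff_monomial, Finset.sum_ite_eq']
  split_ifs with hd
  · rw [hr, mul_div_cancel₀ _ hb]
  · rw [notMem_support_iff.1 hd, mul_zero]

theorem statement11 (F : Type) [Field F] [Fintype F] (f : Polynomial F)
    (hf : IsExceptional F f) :
    ∃ N : ℕ, 0 < N ∧ ∀ m : ℕ, 0 < m → Nat.Coprime m N →
      ∀ (E : Type) [Field E] [Fintype E] [Algebra F E],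
        Fintype.card E = Fintype.card F ^ m →
        IsExceptional E (f.map (algebraMap F E)) := by
  set G : MvPolynomial (Fin 2) F :=
    Polynomial.aeval (MvPolynomial.X 0) f - Polynomial.aeval (MvPolynomial.X 1) f with hG
  set g := map (algebraMap F (AlgebraicClosure F)) G with hgdef
  have hg : g ≠ 0 := (map_ne_zero_iff _ (map_injective _ (algebraMap F _).injective)).2
    hf.aeval_sub_aeval_ne_zero
  refine ⟨coeffRatioDegree g, coeffRatioDegree_pos g, fun m _ hmN E _ _ _ hE P hPdvd hPirr => ?_⟩
  have hm : Module.finrank F E = m := Nat.pow_right_injective Fintype.one_lt_card <|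
    (Module.card_eq_pow_finrank (K := F) (V := E)).symm.trans hE
  rw [← map_aeval_X_sub_aeval_X, ← hG] at hPdvd
  have : IsAlgClosure F (AlgebraicClosure E) := .ofAlgebraic F E _
  let φ : AlgebraicClosure E ≃ₐ[F] AlgebraicClosure F := IsAlgClosure.equiv F _ _
  let ι : E →ₐ[F] AlgebraicClosure F :=
    (φ : AlgebraicClosure E →ₐ[F] AlgebraicClosure F).comp (IsScalarTower.toAlgHom F E _)
  have hPι : Irreducible (map (ι : E →+* AlgebraicClosure F) P) := by
    have := (MulEquiv.irreducible_iff (mapEquiv (Fin 2) φ.toRingEquiv)).2 hPirr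
    rw [mapEquiv_apply, map_map] at this
    exact this
  have hmapι (R : MvPolynomial (Fin 2) F) :
      map (ι : E →+* AlgebraicClosure F) (map (algebraMap F E) R) =
        map (algebraMap F (AlgebraicClosure F)) R := by
    rw [map_map, ι.comp_algebraMap]
  have hPg : map (ι : E →+* AlgebraicClosure F) P ∣ g := by
    rw [hgdef, ← hmapι]
    exact map_dvd _ hPdvd
  obtain ⟨e, he, P', rfl⟩ := exists_eq_C_mul_map_of_coprime ι hg (hm ▸ hmN) hPι hPg
  have hCe : IsUnit (C e : MvPolynomial (Fin 2) E) := he.isUnit.map C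
  obtain ⟨c, hc, rfl⟩ := hf P' (dvd_of_map_algebraMap_dvd ((dvd_mul_left _ _).trans hPdvd)) (by
    rw [map_mul, hmapι, irreducible_isUnit_mul (hCe.map _)] at hPι
    exact hPι)
  refine ⟨e * algebraMap F E c, mul_ne_zero he ((map_ne_zero _).2 hc), ?_⟩
  simp [mul_assoc]
end

section
/- Let f(X) = u_1(u_2(···u_k(X)···)) be a composition of polynomials u_i(X) in F_q[X]. Then f(X) is exceptional over F_q if and only if each u_i(X) is exceptional over F_q. -/
/-- `f ∈ F[X]` is exceptional over the finite field `F` iff `f` permutes `F_{q^m}` for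
infinitely many positive integers `m` (this characterization is used as the definition). -/
def IsExceptionalPerm (F : Type) [Field F] [Fintype F] (f : Polynomial F) : Prop :=
  {m : ℕ | 0 < m ∧ ∀ (E : Type) [Field E] [Fintype E] [Algebra F E],
      Fintype.card E = Fintype.card F ^ m →
      Function.Bijective fun x : E => Polynomial.aeval x f}.Infinite

section

open Polynomial

theorem Polynomial.C_X_sub_C_dvd_sub_map_eval {R : Type*} [CommRing R] (x : R) (p : R[X][X]) :
    C (X - C x) ∣ p - (p.map (evalRingHom x)).map C := by
  rw [C_dvd_iff_dvd_coeff]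
  intro i
  simpa using X_sub_C_dvd_sub_C_eval

/-- Filtering by powers of `z` bounds the dimension of a quotient of `L[X][Y]` in which
`z ^ M = 0`. -/
theorem exists_sum_pow_mul_of_forall_sub_mem {L Q : Type*} [Field L] [CommRing Q] [Algebra L Q]
    (z y : Q) (n M : ℕ)
    (H : ∀ e : Q, ∃ (s : Fin n → L) (e' : Q), e = ∑ l, s l • y ^ (l : ℕ) + z * e') (e : Q) :
    ∃ (s : Fin M × Fin n → L) (e' : Q),
      e = ∑ i, s i • (z ^ (i.1 : ℕ) * y ^ (i.2 : ℕ)) + z ^ M * e' := by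
  induction M with
  | zero => exact ⟨0, e, by simp⟩
  | succ M ih =>
    obtain ⟨s, e', rfl⟩ := ih
    obtain ⟨t, e'', rfl⟩ := H e'
    refine ⟨fun i => Fin.lastCases (motive := fun _ => L) (t i.2) (fun j => s (j, i.2)) i.1,
      e'', ?_⟩
    simp only [Fintype.sum_prod_type, Fin.sum_univ_castSucc, Fin.lastCases_castSucc,
      Fin.lastCases_last, Fin.val_castSucc, Fin.val_last, mul_add, Finset.mul_sum, mul_smul_comm]
    ring

theorem exists_linear_relation_of_pow_eq_zero {L Q ι : Type*} [Field L] [CommRing Q] [Algebra L Q]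
    [Fintype ι] (z y : Q) (n M : ℕ)
    (H : ∀ e : Q, ∃ (s : Fin n → L) (e' : Q), e = ∑ l, s l • y ^ (l : ℕ) + z * e')
    (hz : z ^ M = 0) (v : ι → Q) (hι : M * n < Fintype.card ι) :
    ∃ c : ι → L, c ≠ 0 ∧ ∑ i, c i • v i = 0 := by
  have hsurj : Function.Surjective
      (Fintype.linearCombination L (fun i : Fin M × Fin n => z ^ (i.1 : ℕ) * y ^ (i.2 : ℕ))) := by
    intro e
    obtain ⟨s, e', he⟩ := exists_sum_pow_mul_of_forall_sub_mem z y n M H e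
    refine ⟨s, ?_⟩
    rw [Fintype.linearCombination_apply, he, hz, zero_mul, add_zero]
  have hfin : Module.Finite L Q := Module.Finite.of_surjective _ hsurj
  have hrank : Module.finrank L Q ≤ M * n := by
    have := LinearMap.finrank_le_finrank_of_surjective hsurj
    simpa using this
  have hker : LinearMap.ker (Fintype.linearCombination L v) ≠ ⊥ := by
    apply LinearMap.ker_ne_bot_of_finrank_lt
    simpa using lt_of_le_of_lt hrank hι
  obtain ⟨c, hc, hc0⟩ := Submodule.exists_mem_ne_zero_of_ne_bot hker
  exact ⟨c, hc0, hc⟩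

theorem exists_linear_relation_in_quotient {L Q : Type*} [Field L] [CommRing Q] [Algebra L Q]
    (π : L[X][X] →ₐ[L] Q) (hπ : Function.Surjective π) {H : L[X][X]} {x y : L} {g : L[X]}
    (hgm : g.Monic) (hgy : g.eval y ≠ 0) (hg : H.map (evalRingHom x) = (X - C y) * g) {M J n : ℕ}
    (hMJ : M * g.natDegree < J * n) (hπH : π H = 0) (hπz : π (C (X - C x)) ^ M = 0)
    (hπg : π (g.map C) ^ M = 0) :
    ∃ c : Fin J × Fin n → L, c ≠ 0 ∧
      π (∑ i, CC (c i) * (C X ^ (i.1 : ℕ) * X ^ (i.2 : ℕ))) = 0 := by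
  have hcop : IsCoprime (X - C y) (g ^ M) := by
    apply IsCoprime.pow_right
    rw [(irreducible_X_sub_C y).coprime_iff_not_dvd, dvd_iff_isRoot]
    exact hgy
  obtain ⟨α, β, hαβ⟩ := hcop
  obtain ⟨w, hw⟩ := C_X_sub_C_dvd_sub_map_eval x H
  obtain ⟨v, hv⟩ : ∃ v, π (g.map C) = π (C (X - C x)) * v := by
    have e1 := congrArg (fun p => π (p.map C)) hαβ
    have e2 := congrArg (fun p => π (p.map C)) hg
    have e3 := congrArg π hw
    simp only [Polynomial.map_add, Polynomial.map_mul, map_mul, map_add, Polynomial.map_pow,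
      map_pow, hπg, mul_zero, add_zero, Polynomial.map_one, map_one, map_sub π, hπH] at e1 e2 e3
    refine ⟨- π w * π (α.map C), ?_⟩
    linear_combination (- π (g.map C)) * e1 - π (α.map C) * e2 - π (α.map C) * e3
  have key : ∀ e : Q, ∃ (s : Fin g.natDegree → L) (e' : Q),
      e = ∑ l, s l • (π X) ^ (l : ℕ) + π (C (X - C x)) * e' := by
    intro e
    obtain ⟨p, rfl⟩ := hπ e
    obtain ⟨u, hu⟩ := C_X_sub_C_dvd_sub_map_eval x p
    have h3 := modByMonic_add_div (p.map (evalRingHom x)) g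
    set p0 := p.map (evalRingHom x) with hp0
    set r := p0 %ₘ g with hr
    have hrdeg : r.natDegree < g.natDegree ∨ r = 0 := by
      by_cases h : g = 1
      · right; rw [hr, h, modByMonic_one]
      · left; exact natDegree_modByMonic_lt _ hgm h
    have hrsum : π (r.map C) = ∑ l : Fin g.natDegree, r.coeff l • (π X) ^ (l : ℕ) := by
      rcases hrdeg with h | h
      · conv_lhs => rw [r.as_sum_range' _ h]
        rw [← Fin.sum_univ_eq_sum_range (fun i => monomial i (r.coeff i))]
        simp only [Polynomial.map_sum, map_sum, map_monomial]
        refine Finset.sum_congr rfl fun i _ => ?_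
        rw [← map_pow, ← map_smul, ← C_mul_X_pow_eq_monomial, Algebra.smul_def]
        rfl
      · simp [h]
    refine ⟨fun l => r.coeff l, π u + v * π ((p0 /ₘ g).map C), ?_⟩
    rw [← hrsum]
    have e1 := congrArg π hu
    have e2 := congrArg (fun p => π (p.map C)) h3
    simp only [Polynomial.map_add, Polynomial.map_mul, map_mul, map_add, map_sub π, hv] at e1 e2
    linear_combination e1 - e2
  obtain ⟨c, hc0, hc⟩ := exists_linear_relation_of_pow_eq_zero _ (π X) g.natDegree M key hπz
    (fun i : Fin J × Fin n => (π (C X)) ^ (i.1 : ℕ) * (π X) ^ (i.2 : ℕ)) (by simpa using hMJ)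
  refine ⟨c, hc0, ?_⟩
  rw [← hc, map_sum]
  refine Finset.sum_congr rfl fun i _ => ?_
  rw [← map_pow π (C X), ← map_pow π X, ← map_mul, ← map_smul, Algebra.smul_def]
  rfl

theorem exists_surjective_algHom_ker.{u, v} (L : Type u) {P : Type v} [Field L] [CommRing P]
    [Algebra L P]
    (I : Ideal P) : ∃ (Q : Type v) (_ : CommRing Q) (_ : Algebra L Q) (π : P →ₐ[L] Q),
      Function.Surjective π ∧ ∀ p, π p = 0 ↔ p ∈ I :=
  ⟨P ⧸ I, inferInstance, inferInstance, Ideal.Quotient.mkₐ L I, Ideal.Quotient.mkₐ_surjective L I,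
    fun _ => Ideal.Quotient.eq_zero_iff_mem⟩

theorem exists_mem_span_off_simple_root {L : Type*} [Field L] {H : L[X][X]} {x y : L} {g : L[X]}
    (hgm : g.Monic) (hgy : g.eval y ≠ 0) (hg : H.map (evalRingHom x) = (X - C y) * g) {M J n : ℕ}
    (hMJ : M * g.natDegree < J * n) :
    ∃ c : Fin J × Fin n → L, c ≠ 0 ∧
      ∑ i, CC (c i) * (C X ^ (i.1 : ℕ) * X ^ (i.2 : ℕ)) ∈
        Ideal.span {H, C (X - C x) ^ M, (g.map C) ^ M} := by
  obtain ⟨Q, _, _, π, hπ, hker⟩ := exists_surjective_algHom_ker L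
    (Ideal.span {H, C (X - C x) ^ M, (g.map C) ^ M})
  have hmem (p : L[X][X]) (hp : p ∈ ({H, C (X - C x) ^ M, (g.map C) ^ M} : Set L[X][X])) :
      π p = 0 := (hker p).2 (Ideal.subset_span hp)
  obtain ⟨c, hc0, hc⟩ := exists_linear_relation_in_quotient π hπ
    hgm hgy hg hMJ (hmem H (by simp))
    (by rw [← map_pow]; exact hmem _ (by simp)) (by rw [← map_pow]; exact hmem _ (by simp))
  exact ⟨c, hc0, (hker _).1 hc⟩

/-- If `H` has a simple root `y` above `x`, then there is a nonzero polynomial of degree less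
than `J` in the first variable which vanishes to order `M` on the branches of `H = 0` over the
line through `x` other than the one through `(x, y)`, as soon as `M * (n - 1) < J * n`. -/
theorem exists_vanishing_off_simple_root {L : Type*} [Field L] (H : L[X][X]) (hH : H.Monic)
    (x y : L) (h0 : H.evalEval x y = 0) (h1 : H.derivative.evalEval x y ≠ 0) {n : ℕ}
    (hn : H.natDegree = n) (M J : ℕ) (hMJ : M * (n - 1) < J * n) :
    ∃ c : Fin J × Fin n → L, c ≠ 0 ∧ ∃ t : L[X][X], ∀ a b : L, H.evalEval a b = 0 →
      (b - y) ^ M * ∑ i, c i * (a ^ (i.1 : ℕ) * b ^ (i.2 : ℕ)) =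
        (a - x) ^ M * t.evalEval a b := by
  subst hn
  have hxm : (H.map (evalRingHom x)).Monic := hH.map _
  have hxroot : (H.map (evalRingHom x)).IsRoot y := by
    rw [IsRoot.def, map_evalRingHom_eval, h0]
  obtain ⟨g, hg⟩ := dvd_iff_isRoot.2 hxroot
  have hgm : g.Monic := (monic_X_sub_C y).of_mul_monic_left (hg ▸ hxm)
  have hgdeg : g.natDegree = H.natDegree - 1 := by
    have : (H.map (evalRingHom x)).natDegree = H.natDegree := hH.natDegree_map _
    rw [hg, (monic_X_sub_C y).natDegree_mul hgm, natDegree_X_sub_C] at this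
    omega
  have hgy : g.eval y ≠ 0 := by
    have : (H.map (evalRingHom x)).derivative.eval y = g.eval y := by
      rw [hg]; simp
    rw [← this, derivative_map, map_evalRingHom_eval]
    exact h1
  obtain ⟨w, hw⟩ := C_X_sub_C_dvd_sub_map_eval x H
  obtain ⟨c, hc0, hc⟩ := exists_mem_span_off_simple_root hgm hgy hg (hgdeg ▸ hMJ)
  refine ⟨c, hc0, ?_⟩
  set R : L[X][X] := ∑ i : Fin J × Fin H.natDegree, CC (c i) * (C X ^ (i.1 : ℕ) * X ^ (i.2 : ℕ))
    with hR
  rw [Ideal.mem_span_insert] at hc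
  obtain ⟨s, r', hr', hRs⟩ := hc
  obtain ⟨t, u, htu⟩ := Ideal.mem_span_pair.1 hr'
  refine ⟨(X - CC y) ^ M * t + (-w) ^ M * u, fun a b hab => ?_⟩
  have e1 : R.evalEval a b = ∑ i, c i * (a ^ (i.1 : ℕ) * b ^ (i.2 : ℕ)) := by
    simp [hR, evalEval_finsetSum, evalEval_mul, evalEval_C]
  have e2 : (a - x) ^ M * t.evalEval a b + g.eval b ^ M * u.evalEval a b = R.evalEval a b := by
    rw [hRs, ← htu]
    simp only [evalEval_add, evalEval_mul, evalEval_pow, evalEval_map_C, evalEval_C, hab]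
    simp
    ring
  have e3 : (b - y) * g.eval b = (a - x) * - w.evalEval a b := by
    have h4 := congrArg (evalEval a b) hw
    rw [hg] at h4
    simp only [evalEval_sub, evalEval_mul, evalEval_map_C, evalEval_C, hab] at h4
    simp at h4
    linear_combination -h4
  rw [← e1, ← e2]
  have e4 := congrArg (· ^ M) e3
  simp only [mul_pow] at e4
  simp only [evalEval_add, evalEval_mul, evalEval_pow, evalEval_sub, evalEval_X, evalEval_CC,
    evalEval_neg]
  linear_combination (u.evalEval a b) * e4

theorem exists_common_denominator_evalEval {A L : Type*} [CommRing A] [IsDomain A] [Field L]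
    [Algebra A L] [IsFractionRing A L] (t : L[X][X]) :
    ∃ d : A, d ≠ 0 ∧ ∀ a b : A, ∃ s : A,
      algebraMap A L s = algebraMap A L d * t.evalEval (algebraMap A L a) (algebraMap A L b) := by
  have hadd (p q : L[X][X])
      (hp : ∃ d : A, d ≠ 0 ∧ ∀ a b : A, ∃ s : A,
        algebraMap A L s = algebraMap A L d * p.evalEval (algebraMap A L a) (algebraMap A L b))
      (hq : ∃ d : A, d ≠ 0 ∧ ∀ a b : A, ∃ s : A,
        algebraMap A L s = algebraMap A L d * q.evalEval (algebraMap A L a) (algebraMap A L b)) :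
      ∃ d : A, d ≠ 0 ∧ ∀ a b : A, ∃ s : A, algebraMap A L s =
        algebraMap A L d * (p + q).evalEval (algebraMap A L a) (algebraMap A L b) := by
    obtain ⟨d, hd, hp⟩ := hp
    obtain ⟨e, he, hq⟩ := hq
    refine ⟨d * e, mul_ne_zero hd he, fun a b => ?_⟩
    obtain ⟨s, hs⟩ := hp a b
    obtain ⟨u, hu⟩ := hq a b
    refine ⟨e * s + d * u, ?_⟩
    rw [evalEval_add, map_add, map_mul, map_mul, map_mul, hs, hu]
    ring
  induction t using Polynomial.induction_on' with
  | add p q hp hq => exact hadd p q hp hq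
  | monomial n p =>
    induction p using Polynomial.induction_on' with
    | add p q hp hq => rw [map_add]; exact hadd _ _ hp hq
    | monomial m r =>
      obtain ⟨⟨s, d⟩, h⟩ := IsLocalization.surj (nonZeroDivisors A) r
      refine ⟨d, nonZeroDivisors.ne_zero d.2, fun a b => ⟨s * a ^ m * b ^ n, ?_⟩⟩
      rw [map_mul, map_mul, map_pow, map_pow, ← h]
      simp [evalEval, eval_monomial]
      ring

/-- A version of `exists_vanishing_off_simple_root` over an integral domain. -/
theorem exists_vanishing_off_simple_root_of_isDomain {A : Type*} [CommRing A] [IsDomain A]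
    (H : A[X][X]) (hH : H.Monic)
    (x y : A) (h0 : H.evalEval x y = 0) (h1 : H.derivative.evalEval x y ≠ 0) (M J : ℕ)
    (hMJ : M * (H.natDegree - 1) < J * H.natDegree) :
    ∃ c : Fin J × Fin H.natDegree → A, c ≠ 0 ∧ ∀ a b : A, H.evalEval a b = 0 →
      (a - x) ^ M ∣ (b - y) ^ M * ∑ i, c i * (a ^ (i.1 : ℕ) * b ^ (i.2 : ℕ)) := by
  set φ := algebraMap A (FractionRing A) with hφ
  have hinj : Function.Injective φ := IsFractionRing.injective A (FractionRing A)
  obtain ⟨c, hc0, t, hct⟩ := exists_vanishing_off_simple_root (H.map (mapRingHom φ)) (hH.map _)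
    (φ x) (φ y) (by rw [map_mapRingHom_evalEval, h0, map_zero])
    (by rw [derivative_map, map_mapRingHom_evalEval]; exact (map_ne_zero_iff φ hinj).2 h1)
    (hH.natDegree_map _) M J hMJ
  obtain ⟨d, hd, hdt⟩ := exists_common_denominator_evalEval (A := A) t
  obtain ⟨e, he⟩ := IsLocalization.exist_integer_multiples_of_finite (nonZeroDivisors A) c
  choose c' hc' using he
  simp only [Algebra.smul_def, ← hφ] at hc' hdt
  have he0 : (e : A) ≠ 0 := nonZeroDivisors.ne_zero e.2
  refine ⟨fun i => d * c' i, ?_, fun a b hab => ?_⟩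
  · obtain ⟨i, hi⟩ := Function.ne_iff.1 hc0
    refine Function.ne_iff.2 ⟨i, mul_ne_zero hd fun h => ?_⟩
    have := hc' i
    rw [h, map_zero] at this
    exact mul_ne_zero ((map_ne_zero_iff φ hinj).2 he0) hi this.symm
  · obtain ⟨s, hs⟩ := hdt a b
    refine ⟨e * s, hinj ?_⟩
    have h2 := hct (φ a) (φ b) (by rw [map_mapRingHom_evalEval, hab, map_zero])
    have h3 : φ (∑ i, d * c' i * (a ^ (i.1 : ℕ) * b ^ (i.2 : ℕ))) =
        φ d * φ e * ∑ i, c i * (φ a ^ (i.1 : ℕ) * φ b ^ (i.2 : ℕ)) := by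
      rw [map_sum, Finset.mul_sum]
      refine Finset.sum_congr rfl fun i _ => ?_
      simp only [map_mul, map_pow, hc']
      ring
    rw [map_mul, h3]
    simp only [map_mul, map_pow, map_sub, hs]
    linear_combination (φ d * φ e) * h2

theorem Polynomial.Monic.resultant_ne_zero_of_irreducible {B : Type*} [CommRing B] [IsDomain B]
    [IsIntegrallyClosed B] {h R : B[X]} (hm : h.Monic) (hi : Irreducible h) (hR : ¬ h ∣ R) {N : ℕ}
    (hN : R.natDegree ≤ N) : resultant h R h.natDegree N ≠ 0 := by
  obtain ⟨e, rfl⟩ := Nat.exists_eq_add_of_le hN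
  rw [resultant_add_right_deg _ _ _ _ _ le_rfl, hm.coeff_natDegree, one_pow, one_mul]
  set φ := algebraMap B (FractionRing B) with hφ
  have hinj : Function.Injective φ := IsFractionRing.injective B (FractionRing B)
  intro h0
  have h1 := resultant_map_map h R h.natDegree R.natDegree φ
  rw [h0, map_zero, ← hm.natDegree_map φ, ← natDegree_map_eq_of_injective hinj R,
    resultant_eq_zero_iff] at h1
  have hi' := (hm.irreducible_iff_irreducible_map_fraction_map (K := FractionRing B)).1 hi
  refine h1.2 (hi'.coprime_iff_not_dvd.2 ?_)
  rwa [← hφ, map_dvd_map _ hinj hm]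

theorem sum_CC_mul_ne_zero {k : Type*} [CommRing k] {J n : ℕ} {c : Fin J × Fin n → k} (hc : c ≠ 0) :
    ∑ i, CC (c i) * (C X ^ (i.1 : ℕ) * X ^ (i.2 : ℕ) : k[X][X]) ≠ 0 := by
  obtain ⟨⟨j, l⟩, h⟩ := Function.ne_iff.1 hc
  intro h0
  apply h
  have h1 := congrArg (fun p : k[X][X] => (p.coeff l).coeff j) h0
  simp only [finsetSum_coeff, ← C_pow, ← mul_assoc, ← C_mul, coeff_C_mul, coeff_X_pow, coeff_zero,
    mul_ite, mul_one, mul_zero, Fintype.sum_prod_type, Fin.val_inj, CC] at h1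
  simpa [coeff_X_pow, Fin.val_inj, apply_ite (fun p : k[X] => p.coeff j)] using h1

theorem natDegree_sum_CC_mul_lt {k : Type*} [CommRing k] {J n : ℕ} (hn : n ≠ 0)
    (c : Fin J × Fin n → k) :
    (∑ i, CC (c i) * (C X ^ (i.1 : ℕ) * X ^ (i.2 : ℕ) : k[X][X])).natDegree < n := by
  refine lt_of_le_of_lt (natDegree_sum_le_of_forall_le (n := n - 1) _ _ fun i _ => ?_) (by omega)
  rw [← C_pow, ← mul_assoc, ← C_mul]
  exact (natDegree_C_mul_X_pow_le _ _).trans (by omega)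

/-- Only finitely many abscissae of the points of the irreducible curve `h = 0` are common with a
curve of smaller degree, uniformly in a ring of parameters. -/
theorem exists_ne_zero_eval_eq_zero_of_sum_eq_zero {k A : Type*} [Field k] [CommRing A]
    [IsDomain A] [Algebra k A] (hA : ∀ a : A, a ≠ 0 → ∃ ψ : A →ₐ[k] k, ψ a ≠ 0)
    {h : k[X][X]} (hm : h.Monic) (hi : Irreducible h) {J n : ℕ} (hn : h.natDegree = n)
    {c : Fin J × Fin n → A} (hc : c ≠ 0) :
    ∃ r : A[X], r ≠ 0 ∧ ∀ a b : A, (h.map (mapRingHom (algebraMap k A))).evalEval a b = 0 →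
      ∑ i, c i * (a ^ (i.1 : ℕ) * b ^ (i.2 : ℕ)) = 0 → r.eval a = 0 := by
  obtain ⟨i₀, hi₀⟩ := Function.ne_iff.1 hc
  have hn0 : n ≠ 0 := (lt_of_le_of_lt (Nat.zero_le _) i₀.2.2).ne'
  set R : A[X][X] := ∑ i, CC (c i) * (C X ^ (i.1 : ℕ) * X ^ (i.2 : ℕ)) with hR
  set H := h.map (mapRingHom (algebraMap k A)) with hH
  have hHd : H.natDegree = n := (hm.natDegree_map _).trans hn
  refine ⟨resultant H R n R.natDegree, fun h0 => ?_, fun a b hab h0 => ?_⟩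
  · obtain ⟨ψ, hψ⟩ := hA _ hi₀
    have h1 := resultant_map_map H R n R.natDegree (mapRingHom (ψ : A →+* k))
    have h2 : H.map (mapRingHom (ψ : A →+* k)) = h := by
      rw [hH, Polynomial.map_map, mapRingHom_comp, AlgHom.comp_algebraMap]
      simp
    have h3 : R.map (mapRingHom (ψ : A →+* k)) =
        ∑ i, CC ((ψ ∘ c) i) * (C X ^ (i.1 : ℕ) * X ^ (i.2 : ℕ)) := by
      simp [hR, Polynomial.map_sum, CC]
    have h4 := sum_CC_mul_ne_zero (c := ψ ∘ c) (Function.ne_iff.2 ⟨i₀, hψ⟩)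
    rw [← h3] at h4
    have h5 := natDegree_sum_CC_mul_lt hn0 (ψ ∘ c)
    rw [← h3, ← hn] at h5
    rw [h0, map_zero, h2] at h1
    subst hn
    exact hm.resultant_ne_zero_of_irreducible hi (hm.not_dvd_of_natDegree_lt h4 h5)
      natDegree_map_le h1
  · obtain ⟨p, q, -, -, hpq⟩ := exists_mul_add_mul_eq_C_resultant H R hHd.le le_rfl
      (Or.inl hn0)
    have h1 : R.evalEval a b = 0 := by
      rw [← h0]
      simp [hR, evalEval_finsetSum, evalEval_mul, evalEval_C]
    have h2 := congrArg (evalEval a b) hpq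
    rwa [evalEval_add, evalEval_mul, evalEval_mul, hab, h1, zero_mul, zero_mul, add_zero,
      evalEval_C, eq_comm] at h2

theorem exists_algHom_apply_ne_zero {k A : Type*} [Field k] [IsAlgClosed k] [CommRing A]
    [IsDomain A] [Algebra k A] [Algebra.FiniteType k A] {a : A} (ha : a ≠ 0) :
    ∃ ψ : A →ₐ[k] k, ψ a ≠ 0 := by
  have : IsJacobsonRing A := isJacobsonRing_of_finiteType (A := k)
  have h1 : a ∉ Ideal.jacobson (⊥ : Ideal A) := by
    rwa [IsJacobsonRing.out this Ideal.isPrime_bot.isRadical, Ideal.mem_bot]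
  rw [Ideal.jacobson, Submodule.mem_sInf] at h1
  push Not at h1
  obtain ⟨m, ⟨-, hm⟩, ham⟩ := h1
  let := Ideal.Quotient.field m
  have : Module.Finite k (A ⧸ m) := finite_of_finite_type_of_isJacobsonRing k (A ⧸ m)
  let e : k ≃ₐ[k] A ⧸ m := AlgEquiv.ofBijective (Algebra.ofId k (A ⧸ m))
    IsAlgClosed.algebraMap_bijective_of_isIntegral
  refine ⟨(e.symm : (A ⧸ m) →ₐ[k] k).comp (Ideal.Quotient.mkₐ k m), ?_⟩
  simpa [Ideal.Quotient.eq_zero_iff_mem] using ham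

theorem Matrix.natDegree_det_le_of_forall_le {R ι : Type*} [CommRing R] [Fintype ι] [DecidableEq ι]
    (P : Matrix ι ι R[X]) {e : ℕ} (hP : ∀ i j, (P i j).natDegree ≤ e) :
    P.det.natDegree ≤ Fintype.card ι * e := by
  rw [Matrix.det_apply]
  refine natDegree_sum_le_of_forall_le _ _ fun σ _ => ?_
  refine (natDegree_smul_le _ _).trans ((natDegree_prod_le _ _).trans ?_)
  simpa using Finset.sum_le_card_nsmul Finset.univ _ e fun i _ => hP (σ i) i

section LeftMulMatrix

variable {k A ι : Type*} [Field k] [CommRing A] [Algebra k[X] A] [Fintype ι] [DecidableEq ι]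
  (b : Module.Basis ι k[X] A)

theorem natDegree_leftMulMatrix_mul_le {u v : A} {d e : ℕ}
    (hu : ∀ i j, (Algebra.leftMulMatrix b u i j).natDegree ≤ d)
    (hv : ∀ i j, (Algebra.leftMulMatrix b v i j).natDegree ≤ e) (i j : ι) :
    (Algebra.leftMulMatrix b (u * v) i j).natDegree ≤ d + e := by
  rw [map_mul, Matrix.mul_apply]
  exact natDegree_sum_le_of_forall_le _ _ fun l _ =>
    natDegree_mul_le.trans (add_le_add (hu _ _) (hv _ _))

theorem natDegree_leftMulMatrix_algebraMap_le (p : k[X]) (i j : ι) :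
    (Algebra.leftMulMatrix b (algebraMap k[X] A p) i j).natDegree ≤ p.natDegree := by
  rw [AlgHom.commutes, Matrix.algebraMap_matrix_apply]
  split_ifs <;> simp

theorem natDegree_leftMulMatrix_pow_le {u : A} {d : ℕ}
    (hu : ∀ i j, (Algebra.leftMulMatrix b u i j).natDegree ≤ d) (l : ℕ) (i j : ι) :
    (Algebra.leftMulMatrix b (u ^ l) i j).natDegree ≤ l * d := by
  induction l generalizing i j with
  | zero => simpa using natDegree_leftMulMatrix_algebraMap_le b 1 i j
  | succ l ih =>
    rw [pow_succ, add_mul, one_mul]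
    exact natDegree_leftMulMatrix_mul_le b ih hu i j

theorem natDegree_norm_le_of_forall_le {u : A} {d : ℕ}
    (hu : ∀ i j, (Algebra.leftMulMatrix b u i j).natDegree ≤ d) :
    (Algebra.norm k[X] u).natDegree ≤ Fintype.card ι * d := by
  rw [Algebra.norm_eq_matrix_det b]
  exact Matrix.natDegree_det_le_of_forall_le _ hu

theorem exists_natDegree_leftMulMatrix_le {κ : Type*} [Finite κ] (c : κ → A) :
    ∃ d, ∀ s i j, (Algebra.leftMulMatrix b (c s) i j).natDegree ≤ d := by
  obtain ⟨d, hd⟩ := (Set.finite_range fun t : κ × ι × ι =>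
    (Algebra.leftMulMatrix b (c t.1) t.2.1 t.2.2).natDegree).bddAbove
  exact ⟨d, fun s i j => hd ⟨(s, i, j), rfl⟩⟩

theorem natDegree_norm_sum_le {J n B K : ℕ} {c : Fin J × Fin n → A} {y : A}
    (hc : ∀ s i j, (Algebra.leftMulMatrix b (c s) i j).natDegree ≤ B)
    (hy : ∀ i j, (Algebra.leftMulMatrix b y i j).natDegree ≤ K) (Q : ℕ) :
    (Algebra.norm k[X] (∑ i, c i * ((algebraMap k[X] A X ^ Q) ^ (i.1 : ℕ) *
      (y ^ Q) ^ (i.2 : ℕ)))).natDegree ≤ Fintype.card ι * (B + (Q * (J - 1) + Q * (n - 1) * K)) := by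
  refine natDegree_norm_le_of_forall_le b fun i j => ?_
  rw [map_sum, Matrix.sum_apply]
  refine natDegree_sum_le_of_forall_le _ _ fun s _ => ?_
  refine natDegree_leftMulMatrix_mul_le b (hc s) (natDegree_leftMulMatrix_mul_le b ?_ ?_) i j
  · intro i j
    rw [← pow_mul, ← map_pow]
    refine (natDegree_leftMulMatrix_algebraMap_le b _ i j).trans ?_
    rw [natDegree_X_pow]
    exact Nat.mul_le_mul_left _ (by have := s.1.2; omega)
  · intro i j
    rw [← pow_mul]
    refine (natDegree_leftMulMatrix_pow_le b hy _ i j).trans ?_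
    exact Nat.mul_le_mul_right _ (Nat.mul_le_mul_left _ (by have := s.2.2; omega))

theorem eval_norm_ne_zero_of_mul_eq (b : Module.Basis ι k[X] A) {x₀ : k} {e v γ : A}
    (h : e * v = 1 + algebraMap k[X] A (X - C x₀) * γ) : (Algebra.norm k[X] e).eval x₀ ≠ 0 := by
  have h1 : (Algebra.norm k[X] (e * v)).eval x₀ = 1 := by
    rw [h, Algebra.norm_eq_matrix_det b, ← coe_evalRingHom, RingHom.map_det, map_add, map_one,
      map_mul, AlgHom.commutes, RingHom.mapMatrix_apply, Matrix.map_add _ (map_add _),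
      Matrix.map_mul]
    have : (algebraMap k[X] (Matrix ι ι k[X]) (X - C x₀)).map (evalRingHom x₀) = 0 := by
      ext i j
      simp [Matrix.algebraMap_matrix_apply, apply_ite (eval x₀)]
    rw [this, zero_mul, add_zero]
    simp
  rw [map_mul, eval_mul] at h1
  exact left_ne_zero_of_mul_eq_one h1

end LeftMulMatrix

theorem card_mul_le_natDegree_norm {k A ι : Type*} [Field k] [CommRing A] [IsDomain A]
    [Algebra k[X] A] [Fintype ι] (b : Module.Basis ι k[X] A) {e ρ : A} {g : k[X]} {M : ℕ} (hρ : ρ ≠ 0)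
    (hdvd : algebraMap k[X] A g ^ M ∣ e ^ M * ρ) {G : Finset k} (hg : ∀ x₀ ∈ G, g.IsRoot x₀)
    (he : ∀ x₀ ∈ G, (Algebra.norm k[X] e).eval x₀ ≠ 0) :
    G.card * (Fintype.card ι * M) ≤ (Algebra.norm k[X] ρ).natDegree := by
  have h1 := map_dvd (Algebra.norm k[X]) hdvd
  rw [map_mul, map_pow, map_pow, Algebra.norm_algebraMap_of_basis b, ← pow_mul] at h1
  have h2 : ∏ x₀ ∈ G, (X - C x₀) ^ (Fintype.card ι * M) ∣ Algebra.norm k[X] ρ := by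
    refine Finset.prod_dvd_of_coprime (fun x _ y _ hxy => ?_) fun x₀ hx₀ => ?_
    · exact (pairwise_coprime_X_sub_C Function.injective_id hxy).pow
    · have h3 := (pow_dvd_pow_of_dvd (dvd_iff_isRoot.2 (hg x₀ hx₀)) (Fintype.card ι * M)).trans h1
      refine IsCoprime.dvd_of_dvd_mul_left (IsCoprime.pow ?_) h3
      rw [(irreducible_X_sub_C x₀).coprime_iff_not_dvd, dvd_iff_isRoot]
      exact he x₀ hx₀
  have h3 : Algebra.norm k[X] ρ ≠ 0 := (Algebra.norm_ne_zero_iff_of_basis b).2 hρ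
  refine le_trans (le_of_eq ?_) (natDegree_le_of_dvd h2 h3)
  rw [natDegree_prod_of_monic _ _ fun x _ => (monic_X_sub_C x).pow _]
  simp

theorem AdjoinRoot.evalEval_map_mapRingHom {k : Type*} [Field k] (h P : k[X][X]) :
    (P.map (mapRingHom (algebraMap k (AdjoinRoot h)))).evalEval (AdjoinRoot.of h X)
      (AdjoinRoot.root h) = AdjoinRoot.mk h P := by
  have : (evalEvalRingHom (AdjoinRoot.of h X) (AdjoinRoot.root h)).comp
      (mapRingHom (mapRingHom (algebraMap k (AdjoinRoot h)))) = AdjoinRoot.mk h := by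
    ext a
    · simp
      rfl
    · simp
    · simp
  exact congrArg (fun f => f P) this

theorem Polynomial.map_mapRingHom_iterateFrobenius_mul {k : Type*} [CommSemiring k] (p : ℕ)
    [ExpChar k p] {r : ℕ} {h : k[X][X]} (hτ : h.map (mapRingHom (iterateFrobenius k p r)) = h)
    (m : ℕ) : h.map (mapRingHom (iterateFrobenius k p (r * m))) = h := by
  induction m with
  | zero => simp
  | succ m ih =>
    rw [mul_add, mul_one, iterateFrobenius_add, ← mapRingHom_comp, ← Polynomial.map_map, hτ, ih]

theorem evalEval_map_algebraMap_pow_eq_zero {k A : Type*} [Field k] [CommRing A] [Algebra k A]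
    (p : ℕ) [ExpChar k p] [ExpChar A p] {e : ℕ} {h : k[X][X]}
    (hτ : h.map (mapRingHom (iterateFrobenius k p e)) = h) {x y : A}
    (h0 : (h.map (mapRingHom (algebraMap k A))).evalEval x y = 0) :
    (h.map (mapRingHom (algebraMap k A))).evalEval (x ^ p ^ e) (y ^ p ^ e) = 0 := by
  have h1 : (h.map (mapRingHom (algebraMap k A))).map (mapRingHom (iterateFrobenius A p e)) =
      h.map (mapRingHom (algebraMap k A)) := by
    conv_rhs => rw [← hτ]
    rw [Polynomial.map_map, Polynomial.map_map, mapRingHom_comp, mapRingHom_comp]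
    congr 2
    ext a
    simp [iterateFrobenius_def]
  have h2 := map_mapRingHom_evalEval (iterateFrobenius A p e)
    (h.map (mapRingHom (algebraMap k A))) x y
  rwa [h1, h0, map_zero] at h2

theorem AdjoinRoot.exists_mul_eq_of_forall_ne {k : Type*} [Field k] [IsAlgClosed k] {h : k[X][X]}
    {x₀ : k} {g : k[X]} (hg : ∀ y₀ : k, g.eval y₀ = 0 → h.evalEval x₀ y₀ ≠ 0) :
    ∃ v γ : AdjoinRoot h, aeval (AdjoinRoot.root h) g * v =
      1 + algebraMap k[X] (AdjoinRoot h) (X - C x₀) * γ := by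
  have hcop : IsCoprime g (h.map (evalRingHom x₀)) := by
    rw [isCoprime_iff_aeval_ne_zero_of_isAlgClosed k k]
    intro y₀
    simp only [coe_aeval_eq_eval, map_evalRingHom_eval]
    exact or_iff_not_imp_left.2 fun h => hg y₀ (not_not.1 h)
  obtain ⟨u, v, huv⟩ := hcop
  obtain ⟨w, hw⟩ := C_X_sub_C_dvd_sub_map_eval x₀ h
  have e1 := congrArg (fun p => AdjoinRoot.mk h (p.map C)) huv
  have e2 := congrArg (AdjoinRoot.mk h) hw
  have e3 : AdjoinRoot.mk h (g.map C) = aeval (AdjoinRoot.root h) g :=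
    (AdjoinRoot.aeval_eq_of_algebra h g).symm
  simp only [Polynomial.map_add, Polynomial.map_mul, Polynomial.map_one, map_add, map_mul, map_one,
    e3] at e1
  rw [map_sub, AdjoinRoot.mk_self, map_mul, AdjoinRoot.mk_C, ← AdjoinRoot.algebraMap_eq] at e2
  refine ⟨AdjoinRoot.mk h (u.map C), AdjoinRoot.mk h w * AdjoinRoot.mk h (v.map C), ?_⟩
  linear_combination e1 + AdjoinRoot.mk h (v.map C) * e2

theorem exists_finset_pow_eq_self {k : Type*} [Field k] [IsAlgClosed k] (p : ℕ) [Fact p.Prime]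
    [CharP k p] {e : ℕ} (he : e ≠ 0) {D : k[X]} (hD : D ≠ 0) :
    ∃ G : Finset k, (∀ x ∈ G, x ^ p ^ e = x ∧ D.eval x ≠ 0) ∧ p ^ e ≤ G.card + D.natDegree := by
  classical
  set g : k[X] := X ^ p ^ e - X with hg
  have h1 : 1 < p ^ e := Nat.one_lt_pow he (Fact.out : p.Prime).one_lt
  have hdeg : g.natDegree = p ^ e := FiniteField.X_pow_card_sub_X_natDegree_eq k h1
  have hg0 : g ≠ 0 := FiniteField.X_pow_card_sub_X_ne_zero k h1
  have hcard : g.roots.toFinset.card = p ^ e := by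
    rw [Multiset.toFinset_card_of_nodup
      (nodup_roots (galois_poly_separable p (p ^ e) (dvd_pow_self p he))),
      ← (IsAlgClosed.splits g).natDegree_eq_card_roots, hdeg]
  refine ⟨g.roots.toFinset \ D.roots.toFinset, fun x hx => ?_, ?_⟩
  · simp only [Finset.mem_sdiff, Multiset.mem_toFinset, mem_roots hg0, mem_roots hD, IsRoot.def]
      at hx
    rw [hg, eval_sub, eval_pow, eval_X] at hx
    exact ⟨sub_eq_zero.1 hx.1, hx.2⟩
  · rw [← hcard]
    refine Finset.card_le_card_sdiff_add_card.trans (Nat.add_le_add_left ?_ _)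
    exact (Multiset.toFinset_card_le _).trans (card_roots' D)

/-- An absolutely irreducible plane curve `h = 0`, defined over the subfield fixed by `x ↦ x ^ q`
and separable over the first coordinate, has points over all large extensions of this subfield,
even away from the zeros of a given polynomial in the first coordinate. -/
theorem exists_pow_eq_self_evalEval_eq_zero {k : Type*} [Field k] [IsAlgClosed k] (p : ℕ)
    [Fact p.Prime] [CharP k p] {r : ℕ} (hr : r ≠ 0) {h : k[X][X]} (hm : h.Monic)
    (hi : Irreducible h) (hd : h.derivative ≠ 0)
    (hτ : h.map (mapRingHom (iterateFrobenius k p r)) = h) {D : k[X]} (hD : D ≠ 0) :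
    ∃ m₀, ∀ m, m₀ ≤ m → ∃ x y : k, x ^ p ^ (r * m) = x ∧ y ^ p ^ (r * m) = y ∧
      h.evalEval x y = 0 ∧ D.eval x ≠ 0 := by
  classical
  have hp : p.Prime := Fact.out
  have hdom : IsDomain (AdjoinRoot h) := AdjoinRoot.isDomain_of_prime hi.prime
  set n := h.natDegree with hn
  have hn0 : n ≠ 0 := fun h0 => hd (by rw [natDegree_eq_zero.1 h0 |>.choose_spec.symm, derivative_C])
  have hinj : Function.Injective (algebraMap k[X] (AdjoinRoot h)) :=
    AdjoinRoot.of.injective_of_degree_ne_zero (degree_ne_of_natDegree_ne hn0)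
  have hchar : CharP (AdjoinRoot h) p :=
    charP_of_injective_algebraMap (algebraMap k (AdjoinRoot h)).injective p
  set x : AdjoinRoot h := algebraMap k[X] (AdjoinRoot h) X with hx
  set y : AdjoinRoot h := AdjoinRoot.root h with hy
  obtain ⟨ι, _, b, hcard⟩ : ∃ (ι : Type) (_ : Fintype ι) (b : Module.Basis ι k[X] (AdjoinRoot h)),
      Fintype.card ι = n := ⟨_, inferInstance, (AdjoinRoot.powerBasis' hm).basis, by simp [hn]⟩
  set H := h.map (mapRingHom (algebraMap k (AdjoinRoot h))) with hH
  have hHd : H.natDegree = n := hm.natDegree_map _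
  have h0 : H.evalEval x y = 0 := by
    rw [← AdjoinRoot.mk_self (f := h)]
    exact AdjoinRoot.evalEval_map_mapRingHom h h
  have h1 : H.derivative.evalEval x y ≠ 0 := by
    have : H.derivative.evalEval x y = AdjoinRoot.mk h h.derivative := by
      rw [hH, derivative_map]
      exact AdjoinRoot.evalEval_map_mapRingHom h _
    rw [this]
    exact AdjoinRoot.mk_ne_zero_of_natDegree_lt hm hd (natDegree_derivative_lt hn0)
  obtain ⟨K, hK⟩ := exists_natDegree_leftMulMatrix_le b (fun _ : Unit => y)
  set s := K * n + 2 with hs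
  set M := n * s with hM
  set J := (n - 1) * s + 1 with hJ
  obtain ⟨c, hc0, hc⟩ := exists_vanishing_off_simple_root_of_isDomain H (hm.map _) x y h0 h1 M J
    (by rw [hHd, hM, hJ, add_mul, one_mul]
        have : n * s * (n - 1) = (n - 1) * s * n := by ring
        omega)
  obtain ⟨B, hB⟩ := exists_natDegree_leftMulMatrix_le b c
  obtain ⟨R, hR0, hR⟩ := exists_ne_zero_eval_eq_zero_of_sum_eq_zero
    (fun a ha => exists_algHom_apply_ne_zero (k := k) ha) hm hi hHd.symm hc0
  have hfin : {m : ℕ | R.eval (x ^ p ^ (r * m)) = 0}.Finite := by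
    have hinj' : Function.Injective fun m : ℕ => x ^ p ^ (r * m) := by
      intro a b hab
      have h2 := congrArg natDegree (hinj (by simpa [hx] using hab) :
        (X ^ p ^ (r * a) : k[X]) = X ^ p ^ (r * b))
      rw [natDegree_X_pow, natDegree_X_pow] at h2
      exact Nat.eq_of_mul_eq_mul_left (Nat.pos_of_ne_zero hr) (Nat.pow_right_injective hp.two_le h2)
    refine Set.Finite.preimage (hinj'.injOn) (s := {a | R.IsRoot a}) ?_
    exact finite_setOfPred_isRoot hR0
  obtain ⟨m₁, hm₁⟩ := hfin.bddAbove
  refine ⟨m₁ + 1 + (B + D.natDegree * M), fun m hmm => ?_⟩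
  by_contra! hno
  have hrm : r * m ≠ 0 := mul_ne_zero hr (by omega)
  set Q := p ^ (r * m) with hQ
  have hmQ : m < Q := (Nat.le_mul_of_pos_left m (Nat.pos_of_ne_zero hr)).trans_lt
    (Nat.lt_pow_self hp.one_lt)
  obtain ⟨G, hG, hGcard⟩ := exists_finset_pow_eq_self p hrm hD
  have hHQ : H.evalEval (x ^ Q) (y ^ Q) = 0 := evalEval_map_algebraMap_pow_eq_zero p
    (map_mapRingHom_iterateFrobenius_mul p hτ m) h0
  set ρ := ∑ i, c i * ((x ^ Q) ^ (i.1 : ℕ) * (y ^ Q) ^ (i.2 : ℕ)) with hρ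
  have hρ0 : ρ ≠ 0 := fun h2 => by
    have := hm₁ (hR _ _ hHQ h2)
    omega
  have key := card_mul_le_natDegree_norm b (e := y ^ Q - y) (g := X ^ Q - X) (M := M) hρ0
    (by rw [map_sub, map_pow]; exact hc _ _ hHQ) (G := G)
    (fun x₀ hx₀ => by
      rw [IsRoot.def, eval_sub, eval_pow, eval_X, (hG x₀ hx₀).1, sub_self]) (fun x₀ hx₀ => by
      obtain ⟨v, γ, hv⟩ := AdjoinRoot.exists_mul_eq_of_forall_ne (h := h) (x₀ := x₀)
        (g := X ^ Q - X) (fun y₀ hy₀ h2 => (hG x₀ hx₀).2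
          (hno x₀ y₀ (hG x₀ hx₀).1 (by simpa [sub_eq_zero] using hy₀) h2))
      exact eval_norm_ne_zero_of_mul_eq b (by simpa using hv))
  have key2 := key.trans (natDegree_norm_sum_le b hB (hK ()) Q)
  rw [hcard, hHd, mul_left_comm] at key2
  have key3 := Nat.le_of_mul_le_mul_left key2 (Nat.pos_of_ne_zero hn0)
  have key4 : Q * M ≤ G.card * M + D.natDegree * M := by
    rw [← add_mul]
    exact Nat.mul_le_mul_right _ hGcard
  obtain ⟨n', hn'⟩ := Nat.exists_eq_succ_of_ne_zero hn0
  have key5 : Q * M = Q * (J - 1) + Q * (n - 1) * K + Q * (K + 2) := by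
    rw [hM, hJ, hs, hn']
    simp only [Nat.succ_eq_add_one, Nat.add_sub_cancel]
    ring
  have key6 : Q * 1 ≤ Q * (K + 2) := Nat.mul_le_mul_left _ (by omega)
  omega

theorem finite_setOf_evalEval_eq_zero {k : Type*} [Field k] {h R : k[X][X]} (hm : h.Monic)
    (hi : Irreducible h) (hR : ¬ h ∣ R) :
    {P : k × k | h.evalEval P.1 P.2 = 0 ∧ R.evalEval P.1 P.2 = 0}.Finite := by
  have hn : h.natDegree ≠ 0 := fun h0 => hi.not_isUnit (by
    rw [eq_one_of_monic_natDegree_zero hm h0]; exact isUnit_one)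
  have hr := hm.resultant_ne_zero_of_irreducible hi hR le_rfl
  obtain ⟨u, v, -, -, huv⟩ := exists_mul_add_mul_eq_C_resultant h R le_rfl le_rfl (Or.inl hn)
  refine ((finite_setOfPred_isRoot hr).biUnion fun x _ =>
    ((finite_setOfPred_isRoot (hm.map (evalRingHom x)).ne_zero).image
      fun y => (x, y))).subset fun P ⟨h1, h2⟩ => ?_
  simp only [Set.mem_iUnion]
  refine ⟨P.1, ?_, P.2, ?_, rfl⟩
  · have h3 := congrArg (evalEval P.1 P.2) huv
    rwa [evalEval_add, evalEval_mul, evalEval_mul, h1, h2, zero_mul, zero_mul, add_zero,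
      evalEval_C, eq_comm] at h3
  · change eval P.2 _ = 0
    rw [map_evalRingHom_eval, h1]

theorem finite_setOf_monic_irreducible_dvd {k : Type*} [Field k] {Φ : k[X][X]} (hΦ : Φ ≠ 0) :
    {h : k[X][X] | h.Monic ∧ Irreducible h ∧ h ∣ Φ}.Finite := by
  classical
  refine (UniqueFactorizationMonoid.normalizedFactors Φ).toFinset.finite_toSet.subset
    fun h ⟨hm, hi, hd⟩ => ?_
  rw [Finset.mem_coe, Multiset.mem_toFinset, UniqueFactorizationMonoid.mem_normalizedFactors_iff' hΦ]
  exact ⟨hi, hm.normalize_eq_self, hd⟩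

theorem exists_monic_irreducible_dvd_evalEval_eq_zero {k : Type*} [Field k] {Φ : k[X][X]}
    (hΦ : IsUnit Φ.leadingCoeff) {x y : k} (h0 : Φ.evalEval x y = 0) :
    ∃ h : k[X][X], h.Monic ∧ Irreducible h ∧ h ∣ Φ ∧ h.evalEval x y = 0 := by
  classical
  have hΦ0 : Φ ≠ 0 := by
    rintro rfl
    simp at hΦ
  obtain ⟨u, hu⟩ := UniqueFactorizationMonoid.prod_normalizedFactors hΦ0
  have h1 : (UniqueFactorizationMonoid.normalizedFactors Φ).prod.evalEval x y = 0 := by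
    have h2 := congrArg (evalEval x y) hu
    rw [evalEval_mul, h0] at h2
    refine (mul_eq_zero.1 h2).resolve_right ?_
    exact ((u.isUnit.map (evalEvalRingHom x y))).ne_zero
  rw [evalEval_multiset_prod, Multiset.prod_eq_zero_iff, Multiset.mem_map] at h1
  obtain ⟨h, hmem, h0⟩ := h1
  obtain ⟨hi, hnorm, hd⟩ := (UniqueFactorizationMonoid.mem_normalizedFactors_iff' hΦ0).1 hmem
  refine ⟨h, ?_, hi, hd, h0⟩
  have h3 : IsUnit h.leadingCoeff := by
    obtain ⟨g, rfl⟩ := hd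
    rw [leadingCoeff_mul] at hΦ
    exact isUnit_of_mul_isUnit_left hΦ
  have h4 := congrArg leadingCoeff hnorm
  rw [leadingCoeff_normalize, normalize_eq_one.2 h3] at h4
  exact h4.symm

theorem Polynomial.irreducible_map_iterateFrobenius {k : Type*} [Field k] (p : ℕ)
    [ExpChar k p] [PerfectRing k p] (e : ℕ) {h : k[X][X]} (hi : Irreducible h) :
    Irreducible (h.map (mapRingHom (iterateFrobenius k p e))) := by
  exact (MulEquiv.irreducible_iff (mapEquiv (mapEquiv (iterateFrobeniusEquiv k p e)))).2 hi

theorem Polynomial.iterate_map_mapRingHom_iterateFrobenius {k : Type*} [CommSemiring k] (p : ℕ)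
    [ExpChar k p] (r l : ℕ) (h : k[X][X]) :
    (fun g : k[X][X] => g.map (mapRingHom (iterateFrobenius k p r)))^[l] h =
      h.map (mapRingHom (iterateFrobenius k p (r * l))) := by
  induction l with
  | zero => simp
  | succ l ih =>
    rw [Function.iterate_succ_apply', ih, mul_add, mul_one, add_comm, iterateFrobenius_add,
      ← mapRingHom_comp, ← Polynomial.map_map]

theorem exists_invariant_factor {k : Type*} [Field k] [IsAlgClosed k] (p : ℕ)
    [Fact p.Prime] [CharP k p] {r : ℕ} {Φ : k[X][X]} (hΦ : IsUnit Φ.leadingCoeff)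
    (hτ : Φ.map (mapRingHom (iterateFrobenius k p r)) = Φ) {T : Set ℕ} (hT : T.Infinite)
    (hTp : ∀ l ∈ T, l.Prime) {z : ℕ → k × k} (hz : T.InjOn z)
    (hzΦ : ∀ l ∈ T, Φ.evalEval (z l).1 (z l).2 = 0)
    (hzx : ∀ l ∈ T, (z l).1 ^ p ^ (r * l) = (z l).1)
    (hzy : ∀ l ∈ T, (z l).2 ^ p ^ (r * l) = (z l).2) :
    ∃ h : k[X][X], h.Monic ∧ Irreducible h ∧ h ∣ Φ ∧
      h.map (mapRingHom (iterateFrobenius k p r)) = h ∧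
      {l ∈ T | h.evalEval (z l).1 (z l).2 = 0}.Infinite := by
  have hΦ0 : Φ ≠ 0 := by
    rintro rfl
    simp at hΦ
  set 𝓗 := {h : k[X][X] | h.Monic ∧ Irreducible h ∧ h ∣ Φ} with h𝓗
  have hfin : Finite 𝓗 := finite_setOf_monic_irreducible_dvd hΦ0
  have hTinf : Infinite T := hT.to_subtype
  choose! h hhm hhi hhd hh0 using fun l (hl : l ∈ T) =>
    exists_monic_irreducible_dvd_evalEval_eq_zero hΦ (hzΦ l hl)
  let σ (g : k[X][X]) : k[X][X] := g.map (mapRingHom (iterateFrobenius k p r))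
  have hσ (l : ℕ) (g : k[X][X]) :
      σ^[l] g = g.map (mapRingHom (iterateFrobenius k p (r * l))) :=
    iterate_map_mapRingHom_iterateFrobenius p r l g
  have hσmem (l : ℕ) (g : k[X][X]) (hg : g ∈ 𝓗) : σ^[l] g ∈ 𝓗 := by
    rw [hσ]
    refine ⟨hg.1.map _, irreducible_map_iterateFrobenius p _ hg.2.1, ?_⟩
    have := Polynomial.map_dvd (mapRingHom (iterateFrobenius k p (r * l))) hg.2.2
    rwa [map_mapRingHom_iterateFrobenius_mul p hτ] at this
  have hmem (l : T) : h l ∈ 𝓗 := ⟨hhm l l.2, hhi l l.2, hhd l l.2⟩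
  obtain ⟨⟨⟨g, hg⟩, ⟨g', hg'⟩⟩, hinf⟩ := Finite.exists_infinite_fiber
    (fun l : T => ((⟨h l, hmem l⟩, ⟨σ^[l] (h l), hσmem l _ (hmem l)⟩) : 𝓗 × 𝓗))
  set U : Set ℕ := {l ∈ T | h l = g ∧ σ^[l] g = g'} with hU
  have hUinf : U.Infinite := by
    have h1 := (Set.infinite_coe_iff.1 hinf).image (Subtype.val_injective.injOn)
    refine h1.mono ?_
    rintro _ ⟨l, hl, rfl⟩
    simp only [Set.mem_preimage, Set.mem_singleton_iff, Prod.mk.injEq, Subtype.mk.injEq] at hl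
    exact ⟨l.2, hl.1, hl.1 ▸ hl.2⟩
  have hzero : ∀ l ∈ U, g.evalEval (z l).1 (z l).2 = 0 := fun l hl => hl.2.1 ▸ hh0 l hl.1
  have hzero' : ∀ l ∈ U, g'.evalEval (z l).1 (z l).2 = 0 := fun l hl => by
    have h1 := map_mapRingHom_evalEval (iterateFrobenius k p (r * l)) g (z l).1 (z l).2
    rwa [← hσ, hl.2.2, hzero l hl, map_zero, iterateFrobenius_def, iterateFrobenius_def,
      hzx l hl.1, hzy l hl.1] at h1
  have hgg : g = g' := by
    have h1 : g ∣ g' := by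
      by_contra hnd
      refine hUinf.image (hz.mono fun l hl => hl.1)
        ((finite_setOf_evalEval_eq_zero hg.1 hg.2.1 hnd).subset ?_)
      rintro _ ⟨l, hl, rfl⟩
      exact ⟨hzero l hl, hzero' l hl⟩
    exact eq_of_monic_of_associated hg.1 hg'.1 (hg.2.1.associated_of_dvd hg'.2.1 h1)
  obtain ⟨l, hl⟩ := hUinf.nonempty
  obtain ⟨l', hl', hne⟩ := hUinf.exists_notMem_finite (Set.finite_singleton l)
  have hper (l : ℕ) (hl : l ∈ U) : Function.IsPeriodicPt σ l g := hl.2.2.trans hgg.symm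
  have h1 := (hper l hl).gcd (hper l' hl')
  rw [(Nat.coprime_primes (hTp l hl.1) (hTp l' hl'.1)).2 fun h => hne h.symm] at h1
  exact ⟨g, hg.1, hg.2.1, hg.2.2, h1, hUinf.mono fun l hl => ⟨hl.1, hzero l hl⟩⟩

theorem isUnit_leadingCoeff_map_C_sub_C {k : Type*} [Field k] {f : k[X]} (hf : f.natDegree ≠ 0) :
    IsUnit (f.map C - C f : k[X][X]).leadingCoeff := by
  have h1 : (C f : k[X][X]).degree < (f.map C : k[X][X]).degree := by
    rw [degree_map_eq_of_injective C_injective]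
    exact degree_C_le.trans_lt (natDegree_pos_iff_degree_pos.1 (Nat.pos_of_ne_zero hf))
  rw [leadingCoeff_sub_of_degree_lt h1, leadingCoeff_map_of_injective C_injective, isUnit_C]
  exact (leadingCoeff_ne_zero.2 (ne_zero_of_natDegree_gt (Nat.pos_of_ne_zero hf))).isUnit

/-- If a polynomial with nonzero derivative is injective on infinitely many of the finite
extensions of the fixed field of Frobenius, then this holds for almost all extensions of prime
degree. -/
theorem finite_setOf_prime_not_injOn_of_derivative_ne_zero {k : Type*} [Field k] [IsAlgClosed k]
    (p : ℕ) [Fact p.Prime] [CharP k p] {r : ℕ} (hr : r ≠ 0) {f : k[X]}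
    (hf : f.derivative ≠ 0) (hτ : f.map (iterateFrobenius k p r) = f)
    (hS : {m : ℕ | Set.InjOn (fun x => f.eval x) {x : k | x ^ p ^ (r * m) = x}}.Infinite) :
    {l : ℕ | l.Prime ∧ ¬ Set.InjOn (fun x => f.eval x) {x : k | x ^ p ^ (r * l) = x}}.Finite := by
  classical
  have hper (m : ℕ) (x : k) : x ^ p ^ (r * m) = x ↔
      Function.IsPeriodicPt (fun a : k => a ^ p ^ r) m x := by
    rw [Function.IsPeriodicPt, Function.IsFixedPt, pow_iterate, ← pow_mul]
  have hfdeg : f.natDegree ≠ 0 := fun h => hf (by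
    rw [eq_C_of_natDegree_eq_zero h, derivative_C])
  have hfib (c : k) : {x : k | f.eval x = c}.Finite := by
    have h1 : f - C c ≠ 0 := fun h => hfdeg (by rw [sub_eq_zero.1 h, natDegree_C])
    refine (finite_setOfPred_isRoot h1).subset fun x hx => ?_
    simpa [sub_eq_zero] using hx
  obtain ⟨m₁, hm₁⟩ := hS.nonempty
  by_contra hT
  set T := {l : ℕ | l.Prime ∧ ¬ Set.InjOn (fun x => f.eval x) {x : k | x ^ p ^ (r * l) = x}}
  have hz (l : ℕ) (hl : l ∈ T) : ∃ z : k × k, z.1 ^ p ^ (r * l) = z.1 ∧ z.2 ^ p ^ (r * l) = z.2 ∧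
      f.eval z.1 = f.eval z.2 ∧ z.1 ≠ z.2 := by
    have h1 := hl.2
    simp only [Set.InjOn, not_forall] at h1
    obtain ⟨x, hx, y, hy, hxy, hne⟩ := h1
    exact ⟨(x, y), hx, hy, hxy, hne⟩
  choose! z hzx hzy hzf hzne using hz
  have hzinj : T.InjOn z := by
    intro l hl l' hl' h
    by_contra hne
    have hg (x : k) (h1 : x ^ p ^ (r * l) = x) (h2 : x ^ p ^ (r * l') = x) :
        x ^ p ^ (r * m₁) = x := by
      have h3 := ((hper _ _).1 h1).gcd ((hper _ _).1 h2)
      rw [(Nat.coprime_primes hl.1 hl'.1).2 hne] at h3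
      exact (hper _ _).2 (by simpa using h3.mul_const m₁)
    exact hzne l hl (hm₁ (hg _ (hzx l hl) (h ▸ hzx l' hl')) (hg _ (hzy l hl) (h ▸ hzy l' hl'))
      (hzf l hl))
  set Φ : k[X][X] := f.map C - C f with hΦ
  have hΦe (x y : k) : Φ.evalEval x y = f.eval y - f.eval x := by
    rw [hΦ, evalEval_sub, evalEval_map_C, evalEval_C]
  have hΦτ : Φ.map (mapRingHom (iterateFrobenius k p r)) = Φ := by
    rw [hΦ, Polynomial.map_sub, Polynomial.map_map, map_C, coe_mapRingHom, hτ]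
    congr 1
    conv_rhs => rw [← hτ]
    rw [Polynomial.map_map]
    congr 1
    ext a
    simp
  obtain ⟨h, hm, hi, ⟨u, hu⟩, hhτ, hinf⟩ := exists_invariant_factor p
    (isUnit_leadingCoeff_map_C_sub_C hfdeg) hΦτ hT (fun l hl => hl.1) hzinj
    (fun l hl => by rw [← hΦ, hΦe, hzf l hl, sub_self]) hzx hzy
  have hd : h.derivative ≠ 0 := by
    intro h0
    have h1 := congrArg derivative hu
    rw [derivative_mul, h0, zero_mul, zero_add, derivative_sub, derivative_C, sub_zero,
      derivative_map] at h1
    refine hinf.image (hzinj.mono fun l hl => hl.1) (((finite_setOfPred_isRoot hf).biUnion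
      fun y _ => (hfib (f.eval y)).image fun x => (x, y)).subset ?_)
    rintro _ ⟨l, ⟨hl, hl0⟩, rfl⟩
    simp only [Set.mem_iUnion]
    refine ⟨(z l).2, ?_, (z l).1, hzf l hl, rfl⟩
    have h2 := congrArg (evalEval (z l).1 (z l).2) h1
    rwa [evalEval_map_C, evalEval_mul, hl0, zero_mul] at h2
  have hD : h.eval X ≠ 0 := by
    intro h0
    have h1 : (X - C X : k[X][X]) ∣ h := dvd_iff_isRoot.2 h0
    have h2 := eq_of_monic_of_associated (monic_X_sub_C X) hm
      ((prime_X_sub_C X).irreducible.associated_of_dvd hi h1)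
    obtain ⟨l, hl, hl0⟩ := hinf.nonempty
    rw [← h2, evalEval_sub, evalEval_X, evalEval_C, eval_X, sub_eq_zero] at hl0
    exact hzne l hl hl0.symm
  obtain ⟨m₀, hm₀⟩ := exists_pow_eq_self_evalEval_eq_zero p hr hm hi hd hhτ hD
  obtain ⟨m, hm, hmm⟩ := hS.exists_gt m₀
  obtain ⟨x, y, hx, hy, hxy, hne⟩ := hm₀ m hmm.le
  have h1 : f.eval x = f.eval y := by
    have h2 := hΦe x y
    rw [hΦ, hu, evalEval_mul, hxy, zero_mul, eq_comm, sub_eq_zero] at h2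
    exact h2.symm
  have h2 : x = y := hm hx hy h1
  subst h2
  apply hne
  have h3 := dvd_iff_isRoot.1 (sub_dvd_eval_sub X (C x) h)
  rwa [IsRoot.def, eval_sub, sub_eq_zero, ← evalEval, hxy] at h3

theorem injOn_eval_expand_iff {k : Type*} [Field k] (p : ℕ) [Fact p.Prime] [CharP k p]
    [PerfectRing k p] (g : k[X]) (e : ℕ) :
    Set.InjOn (fun x => (expand k p g).eval x) {x : k | x ^ p ^ e = x} ↔
      Set.InjOn (fun x => g.eval x) {x : k | x ^ p ^ e = x} := by
  simp only [Set.InjOn, expand_eval, Set.mem_ofPred_eq]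
  constructor
  · intro h x hx y hy hxy
    obtain ⟨x, rfl⟩ := (bijective_frobenius k p).2 x
    obtain ⟨y, rfl⟩ := (bijective_frobenius k p).2 y
    have hfix (x : k) (hx : frobenius k p x ^ p ^ e = frobenius k p x) : x ^ p ^ e = x :=
      (bijective_frobenius k p).1 (by rwa [map_pow])
    rw [h (hfix x hx) (hfix y hy) hxy]
  · intro h x hx y hy hxy
    exact (bijective_frobenius k p).1 (h (by rw [← map_pow, hx])
      (by rw [← map_pow, hy]) hxy)

theorem finite_setOf_prime_not_injOn {k : Type*} [Field k] [IsAlgClosed k]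
    (p : ℕ) [Fact p.Prime] [CharP k p] {r : ℕ} (hr : r ≠ 0) (f : k[X])
    (hτ : f.map (iterateFrobenius k p r) = f)
    (hS : {m : ℕ | Set.InjOn (fun x => f.eval x) {x : k | x ^ p ^ (r * m) = x}}.Infinite) :
    {l : ℕ | l.Prime ∧ ¬ Set.InjOn (fun x => f.eval x) {x : k | x ^ p ^ (r * l) = x}}.Finite := by
  have hp : p.Prime := Fact.out
  induction hd : f.natDegree using Nat.strong_induction_on generalizing f with
  | _ d ih =>
    by_cases hf : f.derivative = 0
    · have hexp := expand_contract p hf hp.ne_zero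
      set g := contract p f with hg
      have hgτ : g.map (iterateFrobenius k p r) = g := by
        ext n
        rw [coeff_map, hg, coeff_contract hp.ne_zero]
        conv_rhs => rw [← hτ, coeff_map]
      have hfdeg : f.natDegree ≠ 0 := by
        intro h0
        obtain ⟨m, hm⟩ := hS.nonempty
        rw [eq_C_of_natDegree_eq_zero h0] at hm
        exact zero_ne_one (hm (show (0 : k) ∈ {x : k | x ^ p ^ (r * m) = x} by simp [hp.ne_zero])
          (show (1 : k) ∈ {x : k | x ^ p ^ (r * m) = x} by simp) (by simp))
      have hlt : g.natDegree < d := by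
        have h1 := natDegree_expand p g
        rw [hexp, hd] at h1
        have h2 := hp.one_lt
        rcases Nat.eq_zero_or_pos g.natDegree with h3 | h3
        · rw [h3] at h1; omega
        · nlinarith
      rw [← hexp] at hS ⊢
      simp only [injOn_eval_expand_iff] at hS ⊢
      exact ih _ hlt g hgτ hS rfl
    · exact finite_setOf_prime_not_injOn_of_derivative_ne_zero p hr hf hτ hS

theorem FiniteField.forall_bijective_aeval_iff_injOn {F : Type} [Field F] [Fintype F] {k : Type*}
    [Field k] [IsAlgClosed k] [Algebra F k] (f : F[X]) {m : ℕ} (hm : 0 < m) :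
    (∀ (E : Type) [Field E] [Fintype E] [Algebra F E],
      Fintype.card E = Fintype.card F ^ m → Function.Bijective fun x : E => aeval x f) ↔
    Set.InjOn (fun x => (f.map (algebraMap F k)).eval x)
      {x : k | x ^ Fintype.card F ^ m = x} := by
  classical
  constructor
  · intro h
    obtain ⟨p, hchar⟩ := CharP.exists F
    obtain ⟨n, hp, -⟩ := FiniteField.card F p
    have : Fact p.Prime := ⟨hp⟩
    have : NeZero m := ⟨hm.ne'⟩
    let : Fintype (FiniteField.Extension F p m) := Fintype.ofFinite _
    have hE : Fintype.card (FiniteField.Extension F p m) = Fintype.card F ^ m := by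
      rw [← Nat.card_eq_fintype_card, ← Nat.card_eq_fintype_card]
      exact FiniteField.natCard_extension F p m
    have hb := (h (FiniteField.Extension F p m) hE).1
    let φ : FiniteField.Extension F p m →ₐ[F] k := IsAlgClosed.lift
    have hφ : Function.Injective φ := φ.toRingHom.injective
    have hQ : 1 < Fintype.card F ^ m := hE ▸ Fintype.one_lt_card
    have hsurj (x : k) (hx : x ^ Fintype.card F ^ m = x) : ∃ a, φ a = x := by
      have hne := FiniteField.X_pow_card_sub_X_ne_zero k hQ
      have hsub : Finset.univ.image φ ⊆
          (X ^ Fintype.card F ^ m - X : k[X]).roots.toFinset := by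
        intro y hy
        obtain ⟨a, -, rfl⟩ := Finset.mem_image.1 hy
        rw [Multiset.mem_toFinset, mem_roots hne, IsRoot.def, eval_sub, eval_pow, eval_X,
          ← map_pow, ← hE, FiniteField.pow_card, sub_self]
      have heq := Finset.eq_of_subset_of_card_le hsub (by
        rw [Finset.card_image_of_injective _ hφ, Finset.card_univ, hE]
        refine (Multiset.toFinset_card_le _).trans ((card_roots' _).trans ?_)
        rw [FiniteField.X_pow_card_sub_X_natDegree_eq k hQ])
      have hx' : x ∈ (X ^ Fintype.card F ^ m - X : k[X]).roots.toFinset := by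
        rw [Multiset.mem_toFinset, mem_roots hne, IsRoot.def, eval_sub, eval_pow, eval_X, hx,
          sub_self]
      rw [← heq] at hx'
      obtain ⟨a, -, ha⟩ := Finset.mem_image.1 hx'
      exact ⟨a, ha⟩
    intro x hx y hy hxy
    obtain ⟨a, rfl⟩ := hsurj x hx
    obtain ⟨b, rfl⟩ := hsurj y hy
    simp only [eval_map_algebraMap, aeval_algHom_apply] at hxy
    rw [hb (hφ hxy)]
  · intro h E _ _ _ hE
    rw [← Finite.injective_iff_bijective]
    let φ : E →ₐ[F] k := IsAlgClosed.lift
    have hφ : Function.Injective φ := φ.toRingHom.injective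
    have hfix (a : E) : φ a ^ Fintype.card F ^ m = φ a := by
      rw [← map_pow, ← hE, FiniteField.pow_card]
    intro a b hab
    refine hφ (h (hfix a) (hfix b) ?_)
    simp only [eval_map_algebraMap, aeval_algHom_apply]
    exact congrArg φ hab

theorem IsExceptionalPerm.finite_setOf_prime {F : Type} [Field F] [Fintype F] {f : F[X]}
    (hf : IsExceptionalPerm F f) :
    {l : ℕ | l.Prime ∧ ¬ ∀ (E : Type) [Field E] [Fintype E] [Algebra F E],
      Fintype.card E = Fintype.card F ^ l →
        Function.Bijective fun x : E => aeval x f}.Finite := by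
  obtain ⟨p, hchar⟩ := CharP.exists F
  obtain ⟨n, hp, hcard⟩ := FiniteField.card F p
  have : Fact p.Prime := ⟨hp⟩
  have : CharP (AlgebraicClosure F) p :=
    charP_of_injective_algebraMap (algebraMap F (AlgebraicClosure F)).injective p
  have key (m : ℕ) (hm : 0 < m) := FiniteField.forall_bijective_aeval_iff_injOn
    (k := AlgebraicClosure F) f hm
  simp only [hcard, ← pow_mul] at key
  have hτ : (f.map (algebraMap F (AlgebraicClosure F))).map
      (iterateFrobenius (AlgebraicClosure F) p n) = f.map (algebraMap F (AlgebraicClosure F)) := by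
    ext i
    rw [coeff_map, coeff_map, iterateFrobenius_def, ← map_pow, ← hcard, FiniteField.pow_card]
  refine (finite_setOf_prime_not_injOn p n.ne_zero _ hτ (hf.mono fun m hm => ?_)).subset ?_
  · refine (key m hm.1).1 ?_
    simpa only [hcard, ← pow_mul] using hm.2
  · intro l hl
    refine ⟨hl.1, fun h => hl.2 ?_⟩
    simpa only [hcard, ← pow_mul] using (key l hl.1.pos).2 h

theorem bijective_aeval_foldr_comp_iff {F E : Type*} [Field F] [Field E] [Finite E] [Algebra F E]
    (l : List F[X]) :
    (Function.Bijective fun x : E => aeval x (l.foldr comp X)) ↔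
      ∀ u ∈ l, Function.Bijective fun x : E => aeval x u := by
  induction l with
  | nil => simpa using! Function.bijective_id
  | cons u l ih =>
    have h : (fun x : E => aeval x ((u :: l).foldr comp X)) =
        (fun x : E => aeval x u) ∘ fun x : E => aeval x (l.foldr comp X) := by
      ext x
      simp [aeval_comp]
    rw [h, List.forall_mem_cons, ← ih]
    constructor
    · intro hb
      exact ⟨Finite.surjective_iff_bijective.1 hb.2.of_comp,
        Finite.injective_iff_bijective.1 hb.1.of_comp⟩
    · exact fun hb => hb.1.comp hb.2

end

theorem statement13 (F : Type) [Field F] [Fintype F] (l : List (Polynomial F))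
    (hl : l ≠ []) :
    IsExceptionalPerm F (l.foldr Polynomial.comp Polynomial.X) ↔
      ∀ u ∈ l, IsExceptionalPerm F u := by
  constructor
  · intro h u hu
    refine Set.Infinite.mono (fun m hm => ?_) h
    exact ⟨hm.1, fun E _ _ _ hE => (bijective_aeval_foldr_comp_iff l).1 (hm.2 E hE) u hu⟩
  · intro h
    classical
    have hfin := l.toFinset.finite_toSet.biUnion fun u hu =>
      (h u (List.mem_toFinset.1 hu)).finite_setOf_prime
    refine Set.Infinite.mono ?_ (Nat.infinite_setOfPred_prime.sdiff hfin)
    rintro m ⟨hm, hmu⟩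
    refine ⟨hm.pos, fun E _ _ _ hE => (bijective_aeval_foldr_comp_iff l).2 fun u hu => ?_⟩
    by_contra hb
    refine hmu (Set.mem_biUnion (List.mem_toFinset.2 hu) ⟨hm, fun hall => hb (hall E hE)⟩)
end

section
/- For f(X) in F_q[X], the following are equivalent: (1) f permutes F_{q^m} for infinitely many positive integers m; (2) there exists a positive integer N such that f permutes F_{q^m} for every positive integer m coprime to N. -/
section CoordDegree

open Polynomial

variable {k S ι : Type*} [Field k] [CommRing S] [Algebra k S] [Algebra k[X] S]
  [IsScalarTower k k[X] S]

/-- Elements all of whose coordinates in the `k[X]`-basis `b` have degree less than `s`. -/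
def coordDegreeLT (b : Module.Basis ι k[X] S) (s : ℕ) : Submodule k S where
  carrier := {x | ∀ i, b.repr x i ∈ degreeLT k s}
  add_mem' hx hy i := by
    rw [map_add]; exact (degreeLT k s).add_mem (hx i) (hy i)
  zero_mem' i := by simp
  smul_mem' a x hx i := by
    have : b.repr (a • x) i = a • b.repr x i := by
      rw [← algebraMap_smul k[X] a x, map_smul, Finsupp.smul_apply, algebraMap_smul]
    rw [this]
    exact (degreeLT k s).smul_mem a (hx i)

variable (b : Module.Basis ι k[X] S)

theorem mem_coordDegreeLT {s : ℕ} {x : S} :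
    x ∈ coordDegreeLT b s ↔ ∀ i, b.repr x i ∈ degreeLT k s := Iff.rfl

theorem coordDegreeLT_mono : Monotone (coordDegreeLT (k := k) b) :=
  fun _ _ hst _ hx i => degreeLT_mono hst (hx i)

theorem mul_mem_degreeLT {s t : ℕ} {p q : k[X]} (hp : p ∈ degreeLT k s)
    (hq : q ∈ degreeLT k t) : p * q ∈ degreeLT k (s + t) := by
  rw [mem_degreeLT] at *
  by_cases h0 : p = 0
  · simp [h0]
  rw [degree_mul]
  by_cases h1 : q = 0
  · simp [h1]
  rw [degree_eq_natDegree h0] at *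
  rw [degree_eq_natDegree h1] at *
  norm_cast at *
  omega

theorem smul_mem_coordDegreeLT {s t : ℕ} {p : k[X]} {x : S} (hp : p ∈ degreeLT k s)
    (hx : x ∈ coordDegreeLT b t) : p • x ∈ coordDegreeLT (k := k) b (s + t) := fun i => by
  rw [map_smul, Finsupp.smul_apply, smul_eq_mul]
  exact mul_mem_degreeLT hp (hx i)

theorem X_pow_smul_mem_coordDegreeLT {e : ℕ} {x : S} (hx : x ∈ coordDegreeLT (k := k) b e)
    {a s : ℕ} (ha : a < s) :
    (X ^ a : k[X]) • x ∈ coordDegreeLT (k := k) b (s + e) :=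
  smul_mem_coordDegreeLT b (mem_degreeLT.2 ((degree_X_pow_le a).trans_lt (by exact_mod_cast ha))) hx

theorem pow_mem_coordDegreeLT {e : ℕ} (he : ∀ s t, ∀ x ∈ coordDegreeLT (k := k) b s,
    ∀ y ∈ coordDegreeLT (k := k) b t, x * y ∈ coordDegreeLT (k := k) b (s + t + e))
    {s : ℕ} {x : S} (hx : x ∈ coordDegreeLT (k := k) b s) (n : ℕ) :
    x ^ (n + 1) ∈ coordDegreeLT (k := k) b ((n + 1) * (s + e)) := by
  induction n with
  | zero => simpa using coordDegreeLT_mono b (Nat.le_add_right s e) hx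
  | succ n ih =>
    rw [pow_succ]
    exact coordDegreeLT_mono b (le_of_eq (by ring)) (he _ _ _ ih _ hx)

theorem basis_mem_coordDegreeLT (i : ι) : b i ∈ coordDegreeLT (k := k) b 1 := fun j => by
  classical
  rw [b.repr_self, mem_degreeLT, Finsupp.single_apply]
  split_ifs
  · simp
  · simp

theorem linearIndependent_X_pow_smul (s : ℕ) :
    LinearIndependent k fun ai : Fin s × ι => (X ^ (ai.1 : ℕ) : k[X]) • b ai.2 := by
  have h := linearIndependent_smul
    (((basisMonomials k).linearIndependent.comp (fun a : Fin s => (a : ℕ)) Fin.val_injective))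
    b.linearIndependent
  convert h using 2 with ai
  simp [X_pow_eq_monomial]

variable [Fintype ι]

theorem exists_mem_coordDegreeLT (x : S) : ∃ s, x ∈ coordDegreeLT (k := k) b s := by
  refine ⟨Finset.univ.sup (fun i => (b.repr x i).natDegree) + 1, fun i => ?_⟩
  rw [mem_degreeLT]
  refine degree_le_natDegree.trans_lt ?_
  exact_mod_cast Nat.lt_succ_of_le
    (Finset.le_sup (f := fun i => (b.repr x i).natDegree) (Finset.mem_univ i))

theorem exists_forall_mem_coordDegreeLT {α : Type*} [Finite α] (g : α → S) :
    ∃ s, ∀ a, g a ∈ coordDegreeLT (k := k) b s := by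
  classical
  have := Fintype.ofFinite α
  choose s hs using fun a => exists_mem_coordDegreeLT (k := k) b (g a)
  exact ⟨Finset.univ.sup s, fun a => coordDegreeLT_mono b (Finset.le_sup (Finset.mem_univ a)) (hs a)⟩

theorem exists_mul_mem_coordDegreeLT : ∃ e, ∀ s t, ∀ x ∈ coordDegreeLT (k := k) b s,
    ∀ y ∈ coordDegreeLT (k := k) b t, x * y ∈ coordDegreeLT (k := k) b (s + t + e) := by
  obtain ⟨e, he⟩ := exists_forall_mem_coordDegreeLT (k := k) b
    (fun ij : ι × ι => b ij.1 * b ij.2)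
  refine ⟨e, fun s t x hx y hy => ?_⟩
  rw [← b.sum_repr x, ← b.sum_repr y, Finset.sum_mul_sum]
  refine Submodule.sum_mem _ fun i _ => Submodule.sum_mem _ fun j _ => ?_
  rw [smul_mul_smul_comm]
  exact smul_mem_coordDegreeLT b (mul_mem_degreeLT (hx i) (hy j)) (he (i, j))

/-- The monomials `X ^ a • b i` with `a < s`. -/
theorem coordDegreeLT_le_span (s : ℕ) : coordDegreeLT (k := k) b s ≤
    Submodule.span k (Set.range fun ai : Fin s × ι => (X ^ (ai.1 : ℕ) : k[X]) • b ai.2) := by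
  intro x hx
  rw [← b.sum_repr x]
  refine Submodule.sum_mem _ fun i _ => ?_
  have hd := mem_degreeLT.1 (hx i)
  generalize b.repr x i = p at hd
  have hp : p = ∑ a : Fin s, p.coeff a • (X ^ (a : ℕ) : k[X]) := by
    rcases s.eq_zero_or_pos with rfl | hs
    · have : p = 0 := by
        by_contra h0
        rw [degree_eq_natDegree h0] at hd
        norm_cast at hd
      simp [this]
    conv_lhs => rw [as_sum_range' p s (by
      by_cases h0 : p = 0
      · simpa [h0] using hs
      · exact (natDegree_lt_iff_degree_lt h0).2 hd)]
    rw [← Fin.sum_univ_eq_sum_range (fun a => monomial a (p.coeff a))]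
    exact Finset.sum_congr rfl fun a _ => by rw [smul_X_eq_monomial]
  rw [hp, Finset.sum_smul]
  refine Submodule.sum_mem _ fun a _ => ?_
  rw [smul_assoc]
  exact Submodule.smul_mem _ _ (Submodule.subset_span ⟨(a, i), rfl⟩)

instance finiteDimensional_coordDegreeLT (s : ℕ) : FiniteDimensional k (coordDegreeLT (k := k) b s) :=
  have : FiniteDimensional k (Submodule.span k
    (Set.range fun ai : Fin s × ι => (X ^ (ai.1 : ℕ) : k[X]) • b ai.2)) :=
    FiniteDimensional.span_of_finite k (Set.finite_range _)
  Submodule.finiteDimensional_of_le (coordDegreeLT_le_span b s)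

theorem finrank_coordDegreeLT_le (s : ℕ) :
    Module.finrank k (coordDegreeLT (k := k) b s) ≤ s * Fintype.card ι := by
  have : FiniteDimensional k (Submodule.span k
    (Set.range fun ai : Fin s × ι => (X ^ (ai.1 : ℕ) : k[X]) • b ai.2)) :=
    FiniteDimensional.span_of_finite k (Set.finite_range _)
  refine (Submodule.finrank_mono (coordDegreeLT_le_span b s)).trans ?_
  exact (finrank_range_le_card _).trans_eq (by simp)

theorem natDegree_norm_le {e : ℕ} (he : ∀ s t, ∀ x ∈ coordDegreeLT (k := k) b s,
    ∀ y ∈ coordDegreeLT (k := k) b t, x * y ∈ coordDegreeLT (k := k) b (s + t + e))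
    {s : ℕ} {c : S} (hc : c ∈ coordDegreeLT (k := k) b s) :
    (Algebra.norm k[X] c).natDegree ≤ Fintype.card ι * (s + e) := by
  classical
  rw [Algebra.norm_eq_matrix_det b, Matrix.det_apply]
  refine natDegree_sum_le_of_forall_le _ _ fun σ _ => ?_
  refine (natDegree_smul_le _ _).trans ((natDegree_prod_le _ _).trans ?_)
  rw [← smul_eq_mul, ← Finset.card_univ]
  refine Finset.sum_le_card_nsmul _ _ _ fun i _ => ?_
  rw [Algebra.leftMulMatrix_eq_repr_mul]
  have h := mem_degreeLT.1 (he _ _ _ hc _ (basis_mem_coordDegreeLT b i) (σ i))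
  rw [natDegree_le_iff_degree_le]
  refine Order.lt_succ_iff.1 (h.trans_le ?_)
  change ((s + 1 + e : ℕ) : WithBot ℕ) ≤ ((s + e + 1 : ℕ) : WithBot ℕ)
  exact_mod_cast le_of_eq (by ring)

theorem finiteDimensional_quotient_span (b : Module.Basis ι k[X] S) [IsDomain S] {c : S} (hc : c ≠ 0) :
    FiniteDimensional k (S ⧸ Ideal.span {c}) := by
  have hfin := finrank_quotient_span_eq_natDegree_norm (F := k) b hc
  by_cases h : (Algebra.norm k[X] c).natDegree = 0
  · have hb : Module.Free k[X] S := Module.Free.of_basis b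
    have hb' : Module.Finite k[X] S := Module.Finite.of_basis b
    have hn : Algebra.norm k[X] c ≠ 0 := Algebra.norm_ne_zero_iff.2 hc
    have hu : IsUnit (Algebra.norm k[X] c) := by
      rw [eq_C_of_natDegree_eq_zero h] at hn ⊢
      exact isUnit_C.2 (isUnit_iff_ne_zero.2 (by simpa using hn))
    have hcu : IsUnit c := by
      rw [Algebra.norm_apply] at hu
      have := (LinearMap.isUnit_iff_isUnit_det _).2 hu
      obtain ⟨y, hy⟩ := ((Module.End.isUnit_iff _).1 this).2 1
      exact IsUnit.of_mul_eq_one y hy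
    have : Subsingleton (S ⧸ Ideal.span {c}) := by
      rw [Ideal.Quotient.subsingleton_iff, Ideal.span_singleton_eq_top]
      exact hcu
    infer_instance
  · exact Module.finite_of_finrank_pos (by omega)

theorem finrank_quotient_span_le [IsDomain S] {e : ℕ}
    (he : ∀ s t, ∀ x ∈ coordDegreeLT (k := k) b s,
    ∀ y ∈ coordDegreeLT (k := k) b t, x * y ∈ coordDegreeLT (k := k) b (s + t + e))
    {s : ℕ} {c : S} (hc : c ∈ coordDegreeLT (k := k) b s) (h0 : c ≠ 0) :
    Module.finrank k (S ⧸ Ideal.span {c}) ≤ Fintype.card ι * (s + e) :=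
  (finrank_quotient_span_eq_natDegree_norm (F := k) b h0).trans_le (natDegree_norm_le b he hc)

end CoordDegree

section Points

variable {k S : Type*} [Field k] [CommRing S] [Algebra k S]

theorem card_algHom_vanishing_le {c : S} [FiniteDimensional k (S ⧸ Ideal.span {c})] :
    {φ : S →ₐ[k] k | φ c = 0}.Finite ∧
      {φ : S →ₐ[k] k | φ c = 0}.ncard ≤ Module.finrank k (S ⧸ Ideal.span {c}) := by
  let g : {φ : S →ₐ[k] k | φ c = 0} → (S ⧸ Ideal.span {c} →ₐ[k] k) := fun φ =>
    Ideal.Quotient.liftₐ _ φ.1 fun a ha => by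
      obtain ⟨d, rfl⟩ := Ideal.mem_span_singleton'.1 ha
      rw [map_mul, φ.2.out, mul_zero]
  have hg : Function.Injective g := fun φ ψ h => by
    ext x
    have := congrArg (fun χ => χ (Ideal.Quotient.mk _ x)) h
    exact this
  have hf : Finite {φ : S →ₐ[k] k | φ c = 0} := Finite.of_injective g hg
  refine ⟨hf, ?_⟩
  rw [← Nat.card_coe_set_eq]
  exact (Nat.card_le_card_of_injective g hg).trans (card_algHom_le_finrank k _ k)

/-- A nonzero element lying in a high power of an ideal cuts out a large quotient. -/
theorem le_finrank_quotient_span_of_mem_pow [IsDomain S] [IsNoetherianRing S] {M : Ideal S}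
    (hM : M ≠ ⊤) {c : S} (hc : c ≠ 0) [FiniteDimensional k (S ⧸ Ideal.span {c})]
    {n : ℕ} (hn : c ∈ M ^ n) : n ≤ Module.finrank k (S ⧸ Ideal.span {c}) := by
  by_contra! hlt
  let I : ℕ → Submodule k (S ⧸ Ideal.span {c}) := fun i =>
    ((M ^ i).map (Ideal.Quotient.mk (Ideal.span {c}))).restrictScalars k
  have hI : Antitone I := fun i j hij x hx => Ideal.map_mono (Ideal.pow_le_pow_right hij) hx
  have hex : ∃ i < n, I i = I (i + 1) := by
    by_contra! hne
    have hstep : ∀ i ≤ n, Module.finrank k (I i) + i ≤ Module.finrank k (S ⧸ Ideal.span {c}) := by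
      intro i
      induction i with
      | zero => exact fun _ => by simpa using Submodule.finrank_le (I 0)
      | succ i ih =>
        intro hi
        have h1 : I (i + 1) < I i := lt_of_le_of_ne (hI (Nat.le_succ i)) (hne i (by omega)).symm
        have := Submodule.finrank_lt_finrank_of_lt h1
        have := ih (by omega)
        omega
    have := hstep n le_rfl
    omega
  obtain ⟨i, hin, hi⟩ := hex
  have hcM : ∀ j ≤ n, Ideal.span {c} ≤ M ^ j := fun j hj =>
    (Ideal.span_singleton_le_iff_mem _).2 (Ideal.pow_le_pow_right hj hn)
  have hcomap : ∀ j ≤ n, ((M ^ j).map (Ideal.Quotient.mk (Ideal.span {c}))).comap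
      (Ideal.Quotient.mk (Ideal.span {c})) = M ^ j := fun j hj => by
    rw [Ideal.comap_map_of_surjective _ Ideal.Quotient.mk_surjective]
    rw [← RingHom.ker_eq_comap_bot, Ideal.mk_ker]
    exact sup_eq_left.2 (hcM j hj)
  have hEq : M ^ i = M ^ (i + 1) := by
    rw [← hcomap i hin.le, ← hcomap (i + 1) hin]
    congr 1
    exact SetLike.ext fun x => SetLike.ext_iff.1 hi x
  have hall : ∀ j, M ^ i ≤ M ^ j := by
    intro j
    rcases le_total j i with h | h
    · exact Ideal.pow_le_pow_right h
    · obtain ⟨r, rfl⟩ := Nat.exists_eq_add_of_le h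
      clear h
      induction r with
      | zero => exact le_rfl
      | succ r ih =>
        calc M ^ i = M ^ i * M := by rw [← pow_succ]; exact hEq
          _ ≤ M ^ (i + r) * M := Ideal.mul_mono_left ih
          _ = M ^ (i + (r + 1)) := by rw [← pow_succ]; rfl
  have hbot : M ^ i ≤ ⊥ := by
    rw [← Ideal.iInf_pow_eq_bot_of_isDomain M hM]
    exact le_iInf hall
  exact hc ((Submodule.mem_bot S).1 (hbot (Ideal.pow_le_pow_right hin.le hn)))

end Points

section Stepanov

open Polynomial

variable {k S ι : Type*} [Field k] [CommRing S] [IsDomain S] [Algebra k S] [Algebra k[X] S]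
  [IsScalarTower k k[X] S] [Fintype ι]

theorem eq_zero_of_forall_algHom_eq_zero (b : Module.Basis ι k[X] S) [Infinite (S →ₐ[k] k)]
    {c : S} (hc : ∀ φ : S →ₐ[k] k, φ c = 0) : c = 0 := by
  by_contra h0
  have := finiteDimensional_quotient_span (k := k) b h0
  have h := (card_algHom_vanishing_le (k := k) (c := c)).1
  rw [Set.eq_univ_of_forall (s := {φ : S →ₐ[k] k | φ c = 0}) hc] at h
  exact Set.infinite_univ h

/-- Elements of small degree stay linearly independent over `p ^ t`-th powers. -/
theorem eq_zero_of_sum_mul_pow_eq_zero (p : ℕ) [Fact p.Prime] [CharP k p] [IsAlgClosed k]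
    (b : Module.Basis ι k[X] S) [Infinite (S →ₐ[k] k)]
    {e : ℕ} (he : ∀ s t, ∀ x ∈ coordDegreeLT (k := k) b s,
      ∀ y ∈ coordDegreeLT (k := k) b t, x * y ∈ coordDegreeLT (k := k) b (s + t + e))
    {α β : Type*} [Fintype α] [Fintype β] {w : α → S} {u : β → S}
    (hw : LinearIndependent k w) (hu : LinearIndependent k u)
    {s t : ℕ} (hws : ∀ i, w i ∈ coordDegreeLT (k := k) b s)
    (ht : Fintype.card ι * (s + e) < p ^ t) {γ : α → β → k}
    (h : ∑ i, ∑ j, γ i j • (w i * u j ^ p ^ t) = 0) (i : α) (j : β) : γ i j = 0 := by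
  have hpp : p.Prime := Fact.out
  have : CharP S p := charP_of_injective_algebraMap (algebraMap k S).injective p
  have : ExpChar S p := ExpChar.prime hpp
  have : ExpChar k p := ExpChar.prime hpp
  have hnoeth : IsNoetherianRing S := by
    have : Module.Finite k[X] S := Module.Finite.of_basis b
    exact IsNoetherianRing.of_finite k[X] S
  have key : ∀ φ : S →ₐ[k] k, ∀ i, ∑ j, γ i j * φ (u j) ^ p ^ t = 0 := by
    intro φ
    rw [Fintype.linearIndependent_iff] at hw
    refine hw _ ?_
    by_contra h0
    have hmem : ∑ i, (∑ j, γ i j * φ (u j) ^ p ^ t) • w i ∈ RingHom.ker φ ^ p ^ t := by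
      have hdiff : ∑ i, (∑ j, γ i j * φ (u j) ^ p ^ t) • w i =
          ∑ i, ∑ j, γ i j • (w i * (algebraMap k S (φ (u j)) - u j) ^ p ^ t) := by
        rw [← sub_zero (∑ i, (∑ j, γ i j * φ (u j) ^ p ^ t) • w i), ← h,
          ← Finset.sum_sub_distrib]
        refine Finset.sum_congr rfl fun i _ => ?_
        rw [Finset.sum_smul, ← Finset.sum_sub_distrib]
        refine Finset.sum_congr rfl fun j _ => ?_
        rw [sub_pow_expChar_pow, mul_sub, smul_sub, mul_smul, ← map_pow, ← map_pow,
          mul_comm (w i) (algebraMap k S _), ← Algebra.smul_def, map_pow]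
      rw [hdiff]
      refine Ideal.sum_mem _ fun i _ => Ideal.sum_mem _ fun j _ => ?_
      refine Submodule.smul_of_tower_mem _ _ (Ideal.mul_mem_left _ _ (Ideal.pow_mem_pow ?_ _))
      simp [RingHom.mem_ker]
    have hdeg : ∑ i, (∑ j, γ i j * φ (u j) ^ p ^ t) • w i ∈ coordDegreeLT (k := k) b s :=
      Submodule.sum_mem _ fun i _ => Submodule.smul_mem _ _ (hws i)
    have := finiteDimensional_quotient_span (k := k) b h0
    have h1 := le_finrank_quotient_span_of_mem_pow (k := k) (RingHom.ker_ne_top φ) h0 hmem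
    have h2 := finrank_quotient_span_le b he hdeg h0
    omega
  have hroot : ∀ i j, ∃ δ, δ ^ p ^ t = γ i j := fun i j =>
    IsAlgClosed.exists_pow_nat_eq _ (pow_pos hpp.pos t)
  choose δ hδ using hroot
  have hz : ∑ j, δ i j • u j = 0 := by
    refine eq_zero_of_forall_algHom_eq_zero b fun φ => ?_
    refine eq_zero_of_pow_eq_zero (n := p ^ t) ?_
    rw [map_sum, sum_pow_char_pow, ← key φ i]
    refine Finset.sum_congr rfl fun j _ => ?_
    rw [map_smul, smul_eq_mul, mul_pow, hδ]
  rw [Fintype.linearIndependent_iff] at hu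
  rw [← hδ, hu _ hz j, zero_pow (pow_pos hpp.pos t).ne']

/-- The auxiliary function of Stepanov's method, in a form due to Bombieri. -/
theorem exists_stepanov_function (p : ℕ) [Fact p.Prime] [CharP k p] [IsAlgClosed k]
    (b : Module.Basis ι k[X] S) [Infinite (S →ₐ[k] k)]
    {T κ : Type*} [CommRing T] [Algebra k T] [Algebra k[X] T] [IsScalarTower k k[X] T]
    [Fintype κ] (b' : Module.Basis κ k[X] T) {r : ℕ} (hr : Fintype.card ι = r + 1)
    (hr' : Fintype.card κ = (r + 1) * r) (f g : S →ₐ[k[X]] T) :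
    ∃ t, ∀ C, ∃ μ₀, ∀ μ ≥ μ₀, ∃ Ψ : S, Ψ ≠ 0 ∧
      Module.finrank k (S ⧸ Ideal.span {Ψ}) + C ≤ (r + 1) * p ^ (μ + t) ∧
      ∀ (φ : S →ₐ[k] k) (χ : T →ₐ[k] k), (∀ x, χ (f x) = φ x) →
        (∀ i, χ (g (b i)) = φ (b i) ^ p ^ (μ + t)) →
        φ (algebraMap k[X] S X) ^ p ^ (μ + t) = φ (algebraMap k[X] S X) → φ Ψ = 0 := by
  have hpp : p.Prime := Fact.out
  have : ExpChar k p := ExpChar.prime hpp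
  obtain ⟨e, he⟩ := exists_mul_mem_coordDegreeLT (k := k) b
  obtain ⟨e', he'⟩ := exists_mul_mem_coordDegreeLT (k := k) b'
  obtain ⟨E₂, hE₂⟩ := exists_forall_mem_coordDegreeLT (k := k) b'
    (Sum.elim (fun i => f (b i)) (fun i => g (b i)))
  set E₁ := E₂ + e' with hE₁
  set l := r * (E₁ + 1) + 1 with hl
  obtain ⟨t, ht⟩ : ∃ t, (r + 1) * (l + 1 + e) < p ^ t :=
    pow_unbounded_of_one_lt _ hpp.one_lt
  refine ⟨t, fun C => ?_⟩
  set R := l + 1 + 2 * e + (1 + e) + C with hR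
  refine ⟨R + r * (R * (l + E₁) + E₁) + 1, fun μ hμ => ?_⟩
  have hP : R + r * (R * (l + E₁) + E₁) + 1 ≤ p ^ μ := hμ.trans (Nat.lt_pow_self hpp.one_lt).le
  obtain ⟨m, hm⟩ : ∃ m, p ^ μ = m + R := ⟨p ^ μ - R, by omega⟩
  let w : Fin l × ι → S := fun ai => (X ^ (ai.1 : ℕ) : k[X]) • b ai.2
  let u : Fin m × ι → S := fun ai => (X ^ (ai.1 : ℕ) : k[X]) • b ai.2
  let v : (Fin l × ι) × (Fin m × ι) → T := fun ij => f (w ij.1) ^ p ^ μ * g (u ij.2)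
  set D := p ^ μ * (l + E₁) + m + E₁ with hD
  have hv : ∀ ij, v ij ∈ coordDegreeLT (k := k) b' D := by
    intro ij
    have h1 : f (w ij.1) ∈ coordDegreeLT (k := k) b' (l + E₂) := by
      simp only [w, map_smul]
      exact X_pow_smul_mem_coordDegreeLT b' (hE₂ (Sum.inl _)) ij.1.1.2
    have h2 : g (u ij.2) ∈ coordDegreeLT (k := k) b' (m + E₂) := by
      simp only [u, map_smul]
      exact X_pow_smul_mem_coordDegreeLT b' (hE₂ (Sum.inr _)) ij.2.1.2
    obtain ⟨n, hn⟩ := Nat.exists_eq_succ_of_ne_zero (pow_pos hpp.pos μ).ne'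
    have h3 := pow_mem_coordDegreeLT b' he' h1 n
    have h4 := he' _ _ _ h3 _ h2
    rw [← Nat.succ_eq_add_one, ← hn] at h4
    exact coordDegreeLT_mono b' (le_of_eq (by rw [hD, hE₁]; ring)) h4
  have hcard : D * Fintype.card κ < Fintype.card ((Fin l × ι) × (Fin m × ι)) := by
    simp only [Fintype.card_prod, Fintype.card_fin, hr, hr']
    have h1 : r * (R * (l + E₁) + E₁) + 1 ≤ m := by omega
    have h2 : r * D < (r + 1) * (l * m) := by
      rw [hD, hm]
      have : (r + 1) * (l * m) = r * (m * l + m + m * E₁) + m := by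
        rw [hl]; ring
      nlinarith
    calc D * ((r + 1) * r) = (r + 1) * (r * D) := by ring
      _ < (r + 1) * ((r + 1) * (l * m)) := Nat.mul_lt_mul_of_pos_left h2 (Nat.succ_pos r)
      _ = _ := by ring
  have hdep : ¬ LinearIndependent k (fun ij => (⟨v ij, hv ij⟩ : coordDegreeLT (k := k) b' D)) :=
    fun hli => by
      have h1 := hli.fintype_card_le_finrank
      have h2 := finrank_coordDegreeLT_le b' D
      omega
  rw [Fintype.not_linearIndependent_iff] at hdep
  obtain ⟨δ, hδ, ij₀, hij₀⟩ := hdep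
  have hδ' : ∑ ij, δ ij • v ij = 0 := by
    have := congrArg Subtype.val hδ
    simpa using this
  choose γ hγ using fun ij => IsAlgClosed.exists_pow_nat_eq (δ ij) (pow_pos hpp.pos μ)
  have hws : ∀ i, w i ∈ coordDegreeLT (k := k) b (l + 1) := fun i =>
    X_pow_smul_mem_coordDegreeLT b (basis_mem_coordDegreeLT b _) i.1.2
  have hus : ∀ i, u i ∈ coordDegreeLT (k := k) b (m + 1) := fun i =>
    X_pow_smul_mem_coordDegreeLT b (basis_mem_coordDegreeLT b _) i.1.2
  set Ψ := ∑ i, ∑ j, γ (i, j) • (w i * u j ^ p ^ t) with hΨ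
  have hΨ0 : Ψ ≠ 0 := by
    intro h0
    have := eq_zero_of_sum_mul_pow_eq_zero p b he (linearIndependent_X_pow_smul b l)
      (linearIndependent_X_pow_smul b m) hws (by rw [hr]; exact ht)
      (γ := fun i j => γ (i, j)) h0 ij₀.1 ij₀.2
    exact hij₀ (by rw [← hγ, this, zero_pow (pow_pos hpp.pos μ).ne'])
  have hΨs : Ψ ∈ coordDegreeLT (k := k) b (l + 1 + p ^ t * (m + 1 + e) + e) := by
    refine Submodule.sum_mem _ fun i _ => Submodule.sum_mem _ fun j _ => Submodule.smul_mem _ _ ?_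
    refine he _ _ _ (hws i) _ ?_
    obtain ⟨n, hn⟩ := Nat.exists_eq_succ_of_ne_zero (pow_pos hpp.pos t).ne'
    rw [hn]
    exact pow_mem_coordDegreeLT b he (hus j) n
  refine ⟨Ψ, hΨ0, ?_, ?_⟩
  · have h1 := finrank_quotient_span_le b he hΨs hΨ0
    rw [hr] at h1
    have ht1 : 1 ≤ p ^ t := Nat.one_le_pow _ _ hpp.pos
    have h2 : l + 1 + p ^ t * (m + 1 + e) + e + e + C ≤ p ^ (μ + t) := by
      rw [pow_add, hm, hR]
      have : l + 1 + 2 * e + C ≤ (l + 1 + 2 * e + C) * p ^ t := Nat.le_mul_of_pos_right _ ht1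
      nlinarith
    calc _ ≤ (r + 1) * (l + 1 + p ^ t * (m + 1 + e) + e + e) + (r + 1) * C :=
          add_le_add h1 (Nat.le_mul_of_pos_left _ (Nat.succ_pos r))
      _ = (r + 1) * (l + 1 + p ^ t * (m + 1 + e) + e + e + C) := by ring
      _ ≤ _ := Nat.mul_le_mul_left _ h2
  · intro φ χ hf hg hX
    refine eq_zero_of_pow_eq_zero (n := p ^ μ) ?_
    have hX' : ∀ q : k[X], χ (algebraMap k[X] T q) = φ (algebraMap k[X] S q) := fun q => by
      rw [← hf, AlgHom.commutes]
    have hu' : ∀ j, χ (g (u j)) = φ (u j) ^ p ^ (μ + t) := fun j => by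
      simp only [u, map_smul]
      rw [Algebra.smul_def, Algebra.smul_def, map_mul, map_mul, hX', hg, mul_pow, map_pow,
        map_pow, pow_right_comm, hX]
    rw [Fintype.sum_prod_type] at hδ'
    rw [hΨ, map_sum, sum_pow_char_pow, ← map_zero χ, ← hδ', map_sum]
    refine Finset.sum_congr rfl fun (i : Fin l × ι) _ => ?_
    rw [map_sum, map_sum, sum_pow_char_pow]
    refine Finset.sum_congr rfl fun j _ => ?_
    simp only [v]
    rw [map_smul, map_smul, smul_eq_mul, smul_eq_mul, mul_pow, hγ, map_mul, map_mul, mul_pow,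
      map_pow, map_pow, hf, hu', ← pow_mul, ← pow_add, add_comm t]

end Stepanov

section PlaneCurve

open Polynomial

variable {k : Type*} [Field k]

/-- The evaluation at a point of a plane curve, on its coordinate ring. -/
noncomputable def curveEval {h : k[X][X]} {x y : k} (hxy : h.evalEval x y = 0) :
    AdjoinRoot h →ₐ[k] k :=
  AdjoinRoot.liftAlgHom h (aeval x) y (by
    have : ((aeval x : k[X] →ₐ[k] k) : k[X] →+* k) = evalRingHom x := by ext <;> simp
    rw [this, eval₂_evalRingHom, hxy])

theorem curveEval_of {h : k[X][X]} {x y : k} (hxy : h.evalEval x y = 0) (q : k[X]) :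
    curveEval hxy (AdjoinRoot.of h q) = q.eval x := by
  simp [curveEval, coe_aeval_eq_eval]

theorem curveEval_root {h : k[X][X]} {x y : k} (hxy : h.evalEval x y = 0) :
    curveEval hxy (AdjoinRoot.root h) = y := by
  simp [curveEval]

theorem curveEval_comp_of {h : k[X][X]} {x y : k} (hxy : h.evalEval x y = 0) :
    ((curveEval hxy : AdjoinRoot h →ₐ[k] k) : AdjoinRoot h →+* k).comp (AdjoinRoot.of h) =
      evalRingHom x := by
  ext a <;> simp [curveEval_of]

theorem curveEval_mk {h : k[X][X]} {x y : k} (hxy : h.evalEval x y = 0) (g : k[X][X]) :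
    curveEval hxy (AdjoinRoot.mk h g) = g.evalEval x y := by
  rw [← AdjoinRoot.aeval_eq, aeval_def, ← AlgHom.coe_toRingHom, hom_eval₂,
    AdjoinRoot.algebraMap_eq]
  rw [← eval₂_evalRingHom, ← curveEval_comp_of hxy]
  congr 1
  exact curveEval_root hxy

theorem curveEval_injective {h : k[X][X]} {x y x' y' : k} (hxy : h.evalEval x y = 0)
    (hxy' : h.evalEval x' y' = 0) (heq : curveEval hxy = curveEval hxy') : x = x' ∧ y = y' := by
  constructor
  · simpa [curveEval_of] using congrArg (fun φ => φ (AdjoinRoot.of h X)) heq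
  · simpa [curveEval_root] using congrArg (fun φ => φ (AdjoinRoot.root h)) heq

theorem exists_evalEval_eq_zero [IsAlgClosed k] {h : k[X][X]} (hm : h.Monic)
    (hd : h.natDegree ≠ 0) (x : k) : ∃ y, h.evalEval x y = 0 := by
  have hmx : (h.map (evalRingHom x)).degree ≠ 0 := by
    rw [hm.degree_map, degree_eq_natDegree hm.ne_zero]
    exact_mod_cast hd
  obtain ⟨y, hy⟩ := IsAlgClosed.exists_root _ hmx
  refine ⟨y, ?_⟩
  rwa [← eval₂_evalRingHom, ← eval_map]

theorem natDegree_ne_zero_of_monic_irreducible {R : Type*} [CommRing R] {h : R[X]}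
    (hm : h.Monic) (hi : Irreducible h) : h.natDegree ≠ 0 := fun h0 => by
  rw [hm.natDegree_eq_zero] at h0
  exact hi.not_isUnit (h0 ▸ isUnit_one)

theorem infinite_algHom_adjoinRoot [IsAlgClosed k] {h : k[X][X]} (hm : h.Monic)
    (hd : h.natDegree ≠ 0) : Infinite (AdjoinRoot h →ₐ[k] k) := by
  have : Infinite k := IsAlgClosed.instInfinite
  choose y hy using exists_evalEval_eq_zero hm hd
  exact Infinite.of_injective (fun x => curveEval (hy x)) fun x x' hxx =>
    (curveEval_injective _ _ hxx).1

theorem ncard_common_zeros_le {h g : k[X][X]}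
    [FiniteDimensional k (AdjoinRoot h ⧸ Ideal.span {AdjoinRoot.mk h g})] :
    {P : k × k | h.evalEval P.1 P.2 = 0 ∧ g.evalEval P.1 P.2 = 0}.Finite ∧
    {P : k × k | h.evalEval P.1 P.2 = 0 ∧ g.evalEval P.1 P.2 = 0}.ncard ≤
      Module.finrank k (AdjoinRoot h ⧸ Ideal.span {AdjoinRoot.mk h g}) := by
  obtain ⟨h1, h2⟩ := card_algHom_vanishing_le (k := k) (c := AdjoinRoot.mk h g)
  have := h1.to_subtype
  let ev : {P : k × k | h.evalEval P.1 P.2 = 0 ∧ g.evalEval P.1 P.2 = 0} →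
      {φ : AdjoinRoot h →ₐ[k] k | φ (AdjoinRoot.mk h g) = 0} := fun P =>
    ⟨curveEval P.2.1, by rw [Set.mem_ofPred_eq, curveEval_mk, P.2.2]⟩
  have hev : Function.Injective ev := fun P P' hPP => by
    have := curveEval_injective P.2.1 P'.2.1 (congrArg Subtype.val hPP)
    exact Subtype.ext (Prod.ext this.1 this.2)
  have := Finite.of_injective ev hev
  refine ⟨Set.toFinite _, ?_⟩
  rw [← Nat.card_coe_set_eq] at h2 ⊢
  exact (Nat.card_le_card_of_injective ev hev).trans h2

theorem finite_common_zeros {h g : k[X][X]} (hm : h.Monic) (hi : Irreducible h)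
    (hg : ¬ h ∣ g) : {P : k × k | h.evalEval P.1 P.2 = 0 ∧ g.evalEval P.1 P.2 = 0}.Finite := by
  have : IsDomain (AdjoinRoot h) := AdjoinRoot.isDomain_of_prime hi.prime
  have : FiniteDimensional k (AdjoinRoot h ⧸ Ideal.span {AdjoinRoot.mk h g}) :=
    finiteDimensional_quotient_span (AdjoinRoot.powerBasis' hm).basis
      (by rwa [Ne, AdjoinRoot.mk_eq_zero])
  exact ncard_common_zeros_le.1

/-- Upper bound for the points of an irreducible plane curve over the fixed `x`-line of a Frobenius
that are moved by it. -/
theorem card_moved_points_add_le (p : ℕ) [Fact p.Prime] [CharP k p] [IsAlgClosed k]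
    {h : k[X][X]} (hm : h.Monic) (hi : Irreducible h) (C : ℕ) :
    ∃ s₀, ∀ s ≥ s₀, ∀ pts : Finset (k × k), (∀ P ∈ pts, h.evalEval P.1 P.2 = 0 ∧
      h.evalEval P.1 (P.2 ^ p ^ s) = 0 ∧ P.2 ^ p ^ s ≠ P.2 ∧ P.1 ^ p ^ s = P.1) →
      pts.card + C ≤ h.natDegree * p ^ s := by
  have hd := natDegree_ne_zero_of_monic_irreducible hm hi
  have hdom : IsDomain (AdjoinRoot h) := AdjoinRoot.isDomain_of_prime hi.prime
  have hinf := infinite_algHom_adjoinRoot hm hd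
  obtain ⟨r, hr⟩ := Nat.exists_eq_succ_of_ne_zero hd
  obtain ⟨h', hh'⟩ := dvd_iff_isRoot.2 (AdjoinRoot.isRoot_root h)
  have hm' : h'.Monic := by
    have h1 := hm.map (AdjoinRoot.of h)
    rw [hh'] at h1
    exact (monic_X_sub_C _).of_mul_monic_left h1
  have hr' : h'.natDegree = r := by
    have h1 := hm.natDegree_map (AdjoinRoot.of h)
    rw [hh', (monic_X_sub_C _).natDegree_mul hm', natDegree_X_sub_C] at h1
    omega
  let b := (AdjoinRoot.powerBasis' hm).basis
  let b' := b.smulTower (AdjoinRoot.powerBasis' hm').basis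
  have hroot : eval₂ (algebraMap k[X] (AdjoinRoot h')) (AdjoinRoot.root h') h = 0 := by
    have h1 := congrArg (eval₂ (AdjoinRoot.of h') (AdjoinRoot.root h')) hh'
    rw [eval₂_mul, AdjoinRoot.eval₂_root, mul_zero, eval₂_map] at h1
    exact h1
  let f : AdjoinRoot h →ₐ[k[X]] AdjoinRoot h' := IsScalarTower.toAlgHom k[X] _ _
  let g : AdjoinRoot h →ₐ[k[X]] AdjoinRoot h' :=
    AdjoinRoot.liftAlgHom h (Algebra.ofId k[X] _) (AdjoinRoot.root h') hroot
  obtain ⟨t, ht⟩ := exists_stepanov_function p b b' (r := r) (by simp [hr])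
    (by simp [hr, hr']) f g
  obtain ⟨μ₀, hμ⟩ := ht C
  refine ⟨μ₀ + t, fun s hs pts hpts => ?_⟩
  obtain ⟨Ψ, hΨ0, hΨ, hΨz⟩ := hμ (s - t) (by omega)
  have hst : s - t + t = s := by omega
  rw [hst] at hΨ hΨz
  obtain ⟨ψ, rfl⟩ := AdjoinRoot.mk_surjective Ψ
  have := finiteDimensional_quotient_span b hΨ0
  obtain ⟨hfin, hcard⟩ := ncard_common_zeros_le (h := h) (g := ψ)
  have hsub : (pts : Set (k × k)) ⊆
      {P : k × k | h.evalEval P.1 P.2 = 0 ∧ ψ.evalEval P.1 P.2 = 0} := by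
    rintro ⟨x, y⟩ hP
    obtain ⟨h1, h2, h3, h4⟩ := hpts _ hP
    refine ⟨h1, ?_⟩
    dsimp only at h1 h2 h3 h4 ⊢
    rw [← curveEval_mk h1]
    have hz : eval₂ ((curveEval h1 : AdjoinRoot h →ₐ[k] k) : AdjoinRoot h →+* k)
        (y ^ p ^ s) h' = 0 := by
      have h5 := congrArg (eval₂ ((curveEval h1 : AdjoinRoot h →ₐ[k] k) : AdjoinRoot h →+* k)
        (y ^ p ^ s)) hh'
      rw [eval₂_mul, eval₂_map, curveEval_comp_of, eval₂_evalRingHom, h2] at h5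
      refine (mul_eq_zero.1 h5.symm).resolve_left ?_
      simpa [curveEval_root, sub_eq_zero] using h3
    refine hΨz (curveEval h1) (AdjoinRoot.liftAlgHom h' (curveEval h1) (y ^ p ^ s) hz) ?_ ?_ ?_
    · intro a
      exact AdjoinRoot.liftAlgHom_of h' (curveEval h1) (y ^ p ^ s) hz a
    · intro i
      simp only [b, PowerBasis.basis_eq_pow, AdjoinRoot.powerBasis'_gen, map_pow, curveEval_root]
      have : g (AdjoinRoot.root h) = AdjoinRoot.root h' :=
        AdjoinRoot.liftAlgHom_root h (Algebra.ofId k[X] _) (AdjoinRoot.root h') hroot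
      rw [this, AdjoinRoot.liftAlgHom_root, pow_right_comm]
    · rw [AdjoinRoot.algebraMap_eq, curveEval_of]
      simpa using h4
  have := Set.ncard_le_ncard hsub hfin
  rw [Set.ncard_coe_finset] at this
  rw [hr]
  exact (Nat.add_le_add_right (this.trans hcard) C).trans hΨ

end PlaneCurve

section ValueSet

open Polynomial

variable {R : Type*} [CommRing R]

theorem natDegree_coeff_prod_X_sub_C_le {ι : Type*} (s : Finset ι) (g : ι → R[X]) {n : ℕ}
    (hg : ∀ a ∈ s, (g a).natDegree ≤ n) {j : ℕ} (hj : j ≤ s.card) :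
    ((∏ a ∈ s, (X - C (g a))).coeff (s.card - j)).natDegree ≤ j * n := by
  have h1 : ∏ a ∈ s, (X - C (g a)) = ((s.val.map g).map fun t => X - C t).prod := by
    rw [Multiset.map_map]; rfl
  rw [h1, Multiset.prod_X_sub_C_coeff _ (by simp), Multiset.card_map, Finset.card_val,
    Nat.sub_sub_self hj, Finset.esymm_map_val]
  have h2 : ((-1 : R[X]) ^ j) = C ((-1) ^ j) := by simp
  rw [h2]
  refine (natDegree_C_mul_le _ _).trans (natDegree_sum_le_of_forall_le _ _ fun t ht => ?_)
  rw [Finset.mem_powersetCard] at ht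
  refine (natDegree_prod_le _ _).trans ?_
  rw [← ht.2, ← smul_eq_mul]
  exact Finset.sum_le_card_nsmul _ _ _ fun a ha => hg a (ht.1 ha)

variable {E : Type*} [Field E] [Fintype E]

theorem coeff_prod_X_sub_C_eval_eq_zero (f : E[X]) {j : ℕ} (hj : 0 < j)
    (hjn : j * f.natDegree < Fintype.card E - 1) (hjE : j < Fintype.card E) :
    (∏ a : E, (X - C (f.eval a))).coeff (Fintype.card E - j) = 0 := by
  classical
  set Q := Fintype.card E with hQ
  let P : E[X][X] := ∏ a : E, (X - C (f.comp (C a * X)))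
  have hP (c : E) : P.map (evalRingHom c) = ∏ a : E, (X - C (f.eval (a * c))) := by
    simp [P, Polynomial.map_prod]
  have hdeg : (P.coeff (Q - j)).natDegree ≤ j * f.natDegree := by
    refine natDegree_coeff_prod_X_sub_C_le Finset.univ _ (fun a _ => ?_) hjE.le
    refine natDegree_comp_le.trans ?_
    exact (Nat.mul_le_mul_left _ ((natDegree_C_mul_le _ _).trans natDegree_X_le)).trans_eq
      (mul_one _)
  have heval (c : E) : (P.coeff (Q - j)).eval c =
      (∏ a : E, (X - C (f.eval (a * c)))).coeff (Q - j) := by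
    rw [← hP, coeff_map, coe_evalRingHom]
  have hne (c : E) (hc : c ≠ 0) : (P.coeff (Q - j)).eval c = (P.coeff (Q - j)).eval 1 := by
    rw [heval, heval]
    congr 1
    simp only [mul_one]
    exact Fintype.prod_equiv (Equiv.mulRight₀ c hc) _ _ fun a => rfl
  have hconst : P.coeff (Q - j) - C ((P.coeff (Q - j)).eval 1) = 0 := by
    refine eq_zero_of_natDegree_lt_card_of_eval_eq_zero' _ (Finset.univ.erase (0 : E))
      (fun c hc => ?_) ?_
    · rw [eval_sub, eval_C, hne c (Finset.ne_of_mem_erase hc), sub_self]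
    · rw [natDegree_sub_C, Finset.card_erase_of_mem (Finset.mem_univ _), Finset.card_univ]
      exact hdeg.trans_lt hjn
  have h0 : (P.coeff (Q - j)).eval 0 = 0 := by
    obtain ⟨p, hp⟩ := CharP.exists E
    obtain ⟨n, hpp, hn⟩ := FiniteField.card E p
    have := Fact.mk hpp
    rw [heval]
    simp only [mul_zero, Finset.prod_const, Finset.card_univ]
    rw [hn, sub_pow_char_pow, ← C_pow, ← hn, coeff_sub, coeff_X_pow, coeff_C, if_neg (by omega),
      if_neg (by omega), sub_zero]
  have h1 : (P.coeff (Q - j)).eval 1 = 0 := by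
    rw [← h0]
    conv_rhs => rw [sub_eq_zero.1 hconst, eval_C]
  rw [heval] at h1
  simpa using h1

/-- A polynomial over a finite field which is not surjective misses many values. -/
theorem card_image_eval_add_lt [DecidableEq E] {f : E[X]} (hf : f.natDegree ≠ 0) {K : ℕ}
    (hK : K * f.natDegree < Fintype.card E - 1) (hs : ¬ Function.Surjective fun a => f.eval a) :
    (Finset.univ.image fun a => f.eval a).card + K < Fintype.card E := by
  set Q := Fintype.card E with hQ
  have hKQ : K < Q - 1 := (Nat.le_mul_of_pos_right K (Nat.pos_of_ne_zero hf)).trans_lt hK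
  let P : E[X] := ∏ a : E, (X - C (f.eval a))
  have hP : P.natDegree = Q := by
    simp [P, natDegree_prod_of_monic _ _ fun a _ => monic_X_sub_C (f.eval a), hQ]
  have hPm : P.Monic := monic_prod_of_monic _ _ fun a _ => monic_X_sub_C _
  have hroot (a : E) : P.eval (f.eval a) = 0 := by
    rw [eval_prod]
    exact Finset.prod_eq_zero (Finset.mem_univ a) (by simp)
  let D := P - (X ^ Q - X)
  have hD : D ≠ 0 := fun hD => hs fun b => by
    have h1 : P.eval b = 0 := by
      rw [sub_eq_zero.1 hD]
      simp [hQ, FiniteField.pow_card]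
    rw [eval_prod, Finset.prod_eq_zero_iff] at h1
    obtain ⟨a, -, ha⟩ := h1
    exact ⟨a, (sub_eq_zero.1 (by simpa using ha)).symm⟩
  have hDdeg : D.natDegree < Q - K := by
    rw [natDegree_lt_iff_degree_lt hD, degree_lt_iff_coeff_zero]
    intro i hi
    rw [coeff_sub, coeff_sub, coeff_X_pow, coeff_X, if_neg (show (1 : ℕ) ≠ i by omega), sub_zero]
    rcases lt_trichotomy i Q with hlt | rfl | hgt
    · have hi' : i = Q - (Q - i) := by omega
      rw [if_neg hlt.ne, sub_zero, hi']
      refine coeff_prod_X_sub_C_eval_eq_zero f (by omega) ?_ (by omega)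
      exact (Nat.mul_le_mul_right _ (by omega)).trans_lt hK
    · rw [if_pos rfl, ← hP, hPm.coeff_natDegree, sub_self]
    · rw [if_neg hgt.ne', coeff_eq_zero_of_natDegree_lt (by omega), sub_zero]
  have hcard : (Finset.univ.image fun a => f.eval a).card ≤ D.natDegree := by
    by_contra! h
    refine hD (eq_zero_of_natDegree_lt_card_of_eval_eq_zero' D _ (fun b hb => ?_) h)
    obtain ⟨a, -, rfl⟩ := Finset.mem_image.1 hb
    simp [D, hroot, hQ, FiniteField.pow_card]
  omega

end ValueSet

section Components

open Polynomial

/-- The monic irreducible factors of a polynomial. -/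
def monicIrreducibleFactors {R : Type*} [CommRing R] (G : R[X]) : Set R[X] :=
  {h | h.Monic ∧ Irreducible h ∧ h ∣ G}

theorem finite_monicIrreducibleFactors {R : Type*} [CommRing R] [IsDomain R]
    [UniqueFactorizationMonoid R] {G : R[X]} (hG : G ≠ 0) :
    (monicIrreducibleFactors G).Finite := by
  classical
  refine ((UniqueFactorizationMonoid.factors G).toFinset.finite_toSet.biUnion
    (t := fun g => {h | h.Monic ∧ Associated h g}) fun g _ => ?_).subset fun h hh => ?_
  · exact Set.Subsingleton.finite fun h hh h' hh' =>
      eq_of_monic_of_associated hh.1 hh'.1 (hh.2.trans hh'.2.symm)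
  · obtain ⟨g, hg, hgh⟩ :=
      UniqueFactorizationMonoid.exists_mem_factors_of_dvd hG hh.2.1 hh.2.2
    exact Set.mem_biUnion (by simpa using hg) ⟨hh.1, hgh⟩

theorem exists_mem_monicIrreducibleFactors {R S : Type*} [CommRing R] [IsDomain R]
    [UniqueFactorizationMonoid R] [CommRing S] [IsDomain S] {G : R[X]}
    (hG : IsUnit G.leadingCoeff) (φ : R[X] →+* S) (hφ : φ G = 0) :
    ∃ h ∈ monicIrreducibleFactors G, φ h = 0 := by
  have hG0 : G ≠ 0 := fun h => by simp [h] at hG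
  have h1 : φ (UniqueFactorizationMonoid.factors G).prod = 0 := by
    obtain ⟨u, hu⟩ := UniqueFactorizationMonoid.factors_prod hG0
    rw [← hu, map_mul] at hφ
    exact (mul_eq_zero.1 hφ).resolve_right (u.isUnit.map φ).ne_zero
  rw [map_multiset_prod, Multiset.prod_eq_zero_iff, Multiset.mem_map] at h1
  obtain ⟨g, hg, hg0⟩ := h1
  have hgG := UniqueFactorizationMonoid.dvd_of_mem_factors hg
  obtain ⟨u, hu⟩ := isUnit_of_dvd_unit (leadingCoeff_dvd_leadingCoeff hgG) hG
  have hCu : IsUnit (C (↑u⁻¹ : R)) := isUnit_C.2 (u⁻¹).isUnit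
  refine ⟨C (↑u⁻¹ : R) * g, ⟨?_, ?_, ?_⟩, by rw [map_mul, hg0, mul_zero]⟩
  · rw [Monic, leadingCoeff_mul, leadingCoeff_C, ← hu, Units.inv_mul]
  · exact (irreducible_isUnit_mul hCu).2 (UniqueFactorizationMonoid.irreducible_of_factor g hg)
  · exact (hCu.mul_left_dvd).2 hgG

theorem exists_pos_iterate_eq {α : Type*} {s : Set α} (hs : s.Finite) {g : α → α}
    (hg : Set.MapsTo g s s) (hinj : Function.Injective g) :
    ∃ N, 0 < N ∧ ∀ a ∈ s, g^[N] a = a := by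
  have := hs.to_subtype
  have hb : Function.Bijective (hg.restrict g s s) :=
    Finite.injective_iff_bijective.1 (hg.restrict_inj.2 hinj.injOn)
  let e := Equiv.ofBijective _ hb
  refine ⟨orderOf e, orderOf_pos e, fun a ha => ?_⟩
  have h1 : (e ^ orderOf e) ⟨a, ha⟩ = ⟨a, ha⟩ := by simp [pow_orderOf_eq_one]
  rw [← Equiv.Perm.iterate_eq_pow] at h1
  have h2 : (e : s → s)^[orderOf e] = (hg.iterate (orderOf e)).restrict _ s s :=
    hg.iterate_restrict _
  rw [h2] at h1
  exact congrArg Subtype.val h1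

variable {k : Type*} [Field k]

/-- The polynomial `f(Y) - f(X)`. -/
noncomputable def differencePoly (f : k[X]) : k[X][X] := f.map C - C f

theorem evalEval_differencePoly (f : k[X]) (x y : k) :
    (differencePoly f).evalEval x y = f.eval y - f.eval x := by
  rw [differencePoly, evalEval_sub, evalEval_map_C, evalEval_C]

theorem isUnit_leadingCoeff_differencePoly {f : k[X]} (hf : f.natDegree ≠ 0) :
    IsUnit (differencePoly f).leadingCoeff := by
  have hf0 : f ≠ 0 := fun h => by simp [h] at hf
  have h1 : (C f : k[X][X]).degree < (f.map (C : k →+* k[X])).degree := by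
    refine degree_C_le.trans_lt ?_
    rw [degree_map_eq_of_injective C_injective, ← natDegree_pos_iff_degree_pos]
    exact Nat.pos_of_ne_zero hf
  rw [differencePoly, leadingCoeff_sub_of_degree_lt h1, leadingCoeff_map_of_injective C_injective,
    isUnit_C]
  exact (leadingCoeff_ne_zero.2 hf0).isUnit

/-- The action of a field automorphism on the coefficients of bivariate polynomials. -/
noncomputable def bivariateMap (σ : k ≃+* k) : k[X][X] ≃+* k[X][X] :=
  mapEquiv (mapEquiv σ)

theorem bivariateMap_apply (σ : k ≃+* k) (h : k[X][X]) :
    bivariateMap σ h = h.map (mapRingHom (σ : k →+* k)) := rfl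

theorem bivariateMap_evalEval (σ : k ≃+* k) (h : k[X][X]) (x y : k) :
    (bivariateMap σ h).evalEval (σ x) (σ y) = σ (h.evalEval x y) :=
  map_mapRingHom_evalEval (σ : k →+* k) h x y

theorem iterate_bivariateMap_evalEval (σ : k ≃+* k) (h : k[X][X]) (x y : k) (m : ℕ) :
    ((bivariateMap σ)^[m] h).evalEval (σ^[m] x) (σ^[m] y) = σ^[m] (h.evalEval x y) := by
  induction m with
  | zero => rfl
  | succ m ih =>
    simp only [Function.iterate_succ_apply']
    rw [bivariateMap_evalEval, ih]

theorem bivariateMap_differencePoly (σ : k ≃+* k) {f : k[X]} (hf : f.map (σ : k →+* k) = f) :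
    bivariateMap σ (differencePoly f) = differencePoly f := by
  rw [differencePoly, map_sub, bivariateMap_apply, bivariateMap_apply, map_C, coe_mapRingHom, hf,
    map_map]
  congr 1
  conv_rhs => rw [← hf, map_map]
  congr 1
  ext; simp

theorem mapsTo_bivariateMap (σ : k ≃+* k) {G : k[X][X]} (hG : bivariateMap σ G = G) :
    Set.MapsTo (bivariateMap σ) (monicIrreducibleFactors G) (monicIrreducibleFactors G) :=
  fun h hh => ⟨by rw [bivariateMap_apply]; exact hh.1.map _,
    (MulEquiv.irreducible_iff (bivariateMap σ)).2 hh.2.1, by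
    have := map_dvd (bivariateMap σ) hh.2.2
    rwa [hG] at this⟩

theorem not_dvd_derivative_of_mem_monicIrreducibleFactors [IsAlgClosed k] {f : k[X]}
    (hf' : derivative f ≠ 0) {h : k[X][X]} (hh : h ∈ monicIrreducibleFactors (differencePoly f)) :
    ¬ h ∣ derivative h := by
  obtain ⟨hm, hi, hd⟩ := hh
  have hdeg := natDegree_ne_zero_of_monic_irreducible hm hi
  intro hdvd
  have h0 : derivative h = 0 := by
    by_contra h0
    exact (degree_derivative_lt hm.ne_zero).not_ge (degree_le_of_dvd hdvd h0)
  have hdvd' : h ∣ (derivative f).map C := by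
    obtain ⟨g, hg⟩ := hd
    have h1 := congrArg derivative hg
    rw [derivative_mul, h0, zero_mul, zero_add, differencePoly, derivative_sub, derivative_C,
      sub_zero, derivative_map] at h1
    exact ⟨_, h1⟩
  have : Infinite k := IsAlgClosed.instInfinite
  refine Set.infinite_univ (α := k) (((derivative f).rootSet_finite k).biUnion
    (t := fun y => {x | f.eval x = f.eval y}) (fun y _ => ?_) |>.subset fun x _ => ?_)
  · have hne : f - C (f.eval y) ≠ 0 := fun h => hf' (by
      rw [sub_eq_zero.1 h, derivative_C])
    refine (rootSet_finite (f - C (f.eval y)) k).subset fun x hx => ?_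
    rw [mem_rootSet]
    exact ⟨hne, by simpa [sub_eq_zero] using hx⟩
  · obtain ⟨y, hy⟩ := exists_evalEval_eq_zero hm hdeg x
    refine Set.mem_biUnion (x := y) ?_ ?_
    · rw [mem_rootSet]
      refine ⟨hf', ?_⟩
      obtain ⟨g, hg⟩ := hdvd'
      have h2 := congrArg (evalEval x y) hg
      rw [evalEval_mul, hy, zero_mul, evalEval_map_C] at h2
      simpa using h2
    · obtain ⟨g, hg⟩ := hd
      have h2 := congrArg (evalEval x y) hg
      rw [evalEval_mul, hy, zero_mul, evalEval_differencePoly, sub_eq_zero] at h2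
      exact h2.symm

end Components

section Counting

open Polynomial

variable {k : Type*} [Field k] [IsAlgClosed k]

theorem finite_pow_eq_self (Q : ℕ) (hQ : 1 < Q) : {x : k | x ^ Q = x}.Finite := by
  have hne : (X ^ Q - X : k[X]) ≠ 0 := FiniteField.X_pow_card_sub_X_ne_zero k hQ
  refine (rootSet_finite (X ^ Q - X : k[X]) k).subset fun x hx => ?_
  rw [mem_rootSet]
  exact ⟨hne, by simpa [sub_eq_zero] using hx⟩

theorem ncard_pow_eq_self (p : ℕ) [CharP k p] {Q : ℕ} (hQ : 1 < Q) (hp : p ∣ Q) :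
    {x : k | x ^ Q = x}.ncard = Q := by
  have hne : (X ^ Q - X : k[X]) ≠ 0 := FiniteField.X_pow_card_sub_X_ne_zero k hQ
  have h1 := card_rootSet_eq_natDegree (K := k) (galois_poly_separable (K := k) p Q hp)
    (IsAlgClosed.splits _)
  rw [FiniteField.X_pow_card_sub_X_natDegree_eq k hQ, ← Nat.card_eq_fintype_card,
    Nat.card_coe_set_eq] at h1
  refine (congrArg Set.ncard (Set.ext fun x => ?_)).trans h1
  rw [mem_rootSet]
  simp [hne, sub_eq_zero]

theorem card_roots_toFinset_of_derivative_ne_zero [DecidableEq k] {g : k[X]} (hg : g ≠ 0)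
    (h : ∀ y, g.eval y = 0 → (derivative g).eval y ≠ 0) :
    g.roots.toFinset.card = g.natDegree := by
  rw [Multiset.toFinset_card_of_nodup, IsAlgClosed.card_roots_eq_natDegree]
  rw [Multiset.nodup_iff_count_le_one]
  intro y
  rw [count_roots]
  by_contra! hlt
  rw [one_lt_rootMultiplicity_iff_isRoot hg] at hlt
  exact h y hlt.1 hlt.2

theorem exists_offDiagonal_zero (p : ℕ) [Fact p.Prime] [CharP k p] {a : ℕ} (ha : a ≠ 0)
    (σ : k ≃+* k) (hσ : ∀ m x, σ^[m] x = x ^ p ^ (a * m)) {h : k[X][X]} (hm : h.Monic)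
    (hi : Irreducible h) (hh' : ¬ h ∣ derivative h) (hX : ¬ h ∣ X - C X) :
    ∃ m₀, ∀ m ≥ m₀, (bivariateMap σ)^[m] h = h →
      ∃ x y : k, x ^ p ^ (a * m) = x ∧ y ^ p ^ (a * m) = y ∧ x ≠ y ∧ h.evalEval x y = 0 := by
  classical
  have hp : p.Prime := Fact.out
  have hc : ¬ h ∣ derivative h * (X - C X) := fun hd => (hi.prime.dvd_or_dvd hd).elim hh' hX
  have hZ := finite_common_zeros hm hi hc
  let B := hZ.toFinset.image Prod.fst
  obtain ⟨s₀, hs₀⟩ := card_moved_points_add_le p hm hi (h.natDegree * B.card + 1)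
  refine ⟨s₀ + 1, fun m hms hfix => ?_⟩
  by_contra! hno
  have hsm : s₀ ≤ a * m := by nlinarith [Nat.pos_of_ne_zero ha]
  have ham : a * m ≠ 0 := Nat.mul_ne_zero ha (by omega)
  have hQ : 1 < p ^ (a * m) := Nat.one_lt_pow ham hp.one_lt
  have hA := finite_pow_eq_self (k := k) _ hQ
  let A := hA.toFinset
  have hAcard : A.card = p ^ (a * m) := by
    rw [← ncard_pow_eq_self (k := k) p hQ (dvd_pow_self p ham), Set.ncard_eq_toFinset_card _ hA]
  let r : k → Finset k := fun x => (h.map (evalRingHom x)).roots.toFinset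
  have hr (x y : k) (hy : y ∈ r x) : h.evalEval x y = 0 := by
    have := isRoot_of_mem_roots (Multiset.mem_toFinset.1 hy)
    rwa [IsRoot, eval_map, eval₂_evalRingHom] at this
  have hB (x y : k) (hx : x ∉ B) (hxy : h.evalEval x y = 0) :
      (derivative h).evalEval x y ≠ 0 ∧ y ≠ x := by
    rw [← not_or]
    intro hor
    refine hx (Finset.mem_image.2 ⟨(x, y), hZ.mem_toFinset.2 ⟨hxy, ?_⟩, rfl⟩)
    rw [evalEval_mul, mul_eq_zero]
    exact hor.imp_right fun h => by simp [h, evalEval_C]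
  let pts : Finset (k × k) := ((A \ B).sigma r).map (Equiv.sigmaEquivProd k k).toEmbedding
  have hpts : pts.card = (A \ B).card * h.natDegree := by
    rw [Finset.card_map, Finset.card_sigma]
    refine Finset.sum_const_nat fun x hx => ?_
    rw [← hm.natDegree_map (evalRingHom x)]
    refine card_roots_toFinset_of_derivative_ne_zero (hm.map _).ne_zero fun y hy => ?_
    rw [derivative_map, eval_map, eval₂_evalRingHom]
    rw [eval_map, eval₂_evalRingHom] at hy
    exact (hB x y (Finset.mem_sdiff.1 hx).2 hy).1
  have hle := hs₀ (a * m) hsm pts fun P hP => by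
    obtain ⟨⟨x, y⟩, hxy, rfl⟩ := Finset.mem_map.1 hP
    obtain ⟨hx, hy⟩ := Finset.mem_sigma.1 hxy
    obtain ⟨hxA, hxB⟩ := Finset.mem_sdiff.1 hx
    have hxQ : x ^ p ^ (a * m) = x := hA.mem_toFinset.1 hxA
    have h0 := hr x y hy
    change h.evalEval x y = 0 ∧ h.evalEval x (y ^ p ^ (a * m)) = 0 ∧ y ^ p ^ (a * m) ≠ y ∧
      x ^ p ^ (a * m) = x
    refine ⟨h0, ?_, fun hyQ => hno x y hxQ hyQ (hB x y hxB h0).2.symm h0, hxQ⟩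
    have h1 := iterate_bivariateMap_evalEval σ h x y m
    rwa [hfix, hσ, hσ, hσ, hxQ, h0, zero_pow (by positivity)] at h1
  have hsub := Finset.le_card_sdiff B A
  rw [hpts] at hle
  rw [hAcard] at hsub
  have h2 : p ^ (a * m) ≤ (A \ B).card + B.card := by omega
  have h3 := Nat.mul_le_mul_left h.natDegree h2
  rw [mul_add, mul_comm h.natDegree (A \ B).card] at h3
  omega

theorem exists_finset_forall_collision_mem (p : ℕ) [Fact p.Prime] [CharP k p] {a : ℕ}
    (ha : a ≠ 0) (σ : k ≃+* k) (hσ : ∀ m x, σ^[m] x = x ^ p ^ (a * m)) {f : k[X]}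
    (hf : f.map (σ : k →+* k) = f) (hf' : derivative f ≠ 0)
    (hS : {m : ℕ | 0 < m ∧ ∀ x y : k, x ^ p ^ (a * m) = x → y ^ p ^ (a * m) = y →
      f.eval x = f.eval y → x = y}.Infinite) :
    ∃ N, 0 < N ∧ ∃ B : Finset k, ∀ M, M.Coprime N → ∀ x y : k, x ^ p ^ (a * M) = x →
      y ^ p ^ (a * M) = y → f.eval x = f.eval y → x ≠ y → x ∈ B := by
  classical
  have hfd : f.natDegree ≠ 0 := fun h => hf' (by
    rw [natDegree_eq_zero.1 h |>.choose_spec.symm, derivative_C])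
  have hlc := isUnit_leadingCoeff_differencePoly hfd
  have hG0 : differencePoly f ≠ 0 := fun h => by simp [h] at hlc
  set H := monicIrreducibleFactors (differencePoly f) with hH
  have hfin : H.Finite := finite_monicIrreducibleFactors hG0
  have hmaps : Set.MapsTo (bivariateMap σ) H H :=
    mapsTo_bivariateMap σ (bivariateMap_differencePoly σ hf)
  obtain ⟨N, hN, hper⟩ := exists_pos_iterate_eq hfin hmaps (bivariateMap σ).injective
  have hzero (h : k[X][X]) (hh : h ∈ H) (x y : k) (hxy : h.evalEval x y = 0) :
      f.eval x = f.eval y := by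
    have := evalEval_dvd x y hh.2.2
    rw [hxy, zero_dvd_iff, evalEval_differencePoly, sub_eq_zero] at this
    exact this.symm
  have hX (h : k[X][X]) (hh : h ∈ H) (hdvd : h ∣ X - C X) : h = X - C X :=
    eq_of_monic_of_associated hh.1 (monic_X_sub_C _)
      ((hh.2.1.dvd_irreducible_iff_associated (irreducible_X_sub_C _)).1 hdvd)
  have hmove (h : k[X][X]) (hh : h ∈ H) (hne : h ≠ X - C X) : bivariateMap σ h ≠ h := by
    intro hfix
    obtain ⟨m₀, hm₀⟩ := exists_offDiagonal_zero p ha σ hσ hh.1 hh.2.1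
      (not_dvd_derivative_of_mem_monicIrreducibleFactors hf' hh) fun hd => hne (hX h hh hd)
    obtain ⟨m, hm, hlt⟩ := hS.exists_gt m₀
    obtain ⟨x, y, hx, hy, hxy, h0⟩ := hm₀ m hlt.le (Function.iterate_fixed hfix m)
    exact hxy (hm.2 x y hx hy (hzero h hh x y h0))
  have hbad : (⋃ h ∈ H, ⋃ h' ∈ H \ {h},
      {P : k × k | h.evalEval P.1 P.2 = 0 ∧ h'.evalEval P.1 P.2 = 0}).Finite := by
    refine hfin.biUnion fun h hh => (hfin.subset Set.sdiff_subset).biUnion fun h' hh' => ?_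
    refine finite_common_zeros hh.1 hh.2.1 fun hd => hh'.2 ?_
    exact (eq_of_monic_of_associated hh.1 hh'.1.1
      ((hh.2.1.dvd_irreducible_iff_associated hh'.1.2.1).1 hd)).symm
  refine ⟨N, hN, hbad.toFinset.image Prod.fst, fun M hM x y hx hy hxy hne => ?_⟩
  obtain ⟨h, hh, h0⟩ := exists_mem_monicIrreducibleFactors hlc (evalEvalRingHom x y)
    (by rw [coe_evalEvalRingHom, evalEval_differencePoly, hxy, sub_self])
  rw [coe_evalEvalRingHom] at h0
  have hhX : h ≠ X - C X := fun h1 => hne (by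
    rw [h1] at h0
    simpa [sub_eq_zero, eq_comm, evalEval_C] using h0)
  have hMh : (bivariateMap σ)^[M] h ≠ h := fun h1 => hmove h hh hhX (by
    have h2 : Function.IsPeriodicPt (bivariateMap σ) (M.gcd N) h :=
      Function.IsPeriodicPt.gcd h1 (hper h hh)
    rwa [hM] at h2)
  have h1 := iterate_bivariateMap_evalEval σ h x y M
  rw [hσ, hσ, hσ, hx, hy, h0, zero_pow (pow_ne_zero _ (Nat.Prime.ne_zero Fact.out))] at h1
  refine Finset.mem_image.2 ⟨(x, y), hbad.mem_toFinset.2 ?_, rfl⟩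
  refine Set.mem_biUnion hh (Set.mem_biUnion ⟨hmaps.iterate M hh, hMh⟩ ⟨h0, h1⟩)

end Counting

section Permutation

open Polynomial

/-- `f` is injective on the elements of `k` fixed by `x ↦ x ^ Q`. -/
def InjOnFixed {F : Type*} (k : Type*) [Field F] [Field k] [Algebra F k] (f : F[X]) (Q : ℕ) :
    Prop :=
  ∀ x y : k, x ^ Q = x → y ^ Q = y → aeval x f = aeval y f → x = y

theorem InjOnFixed.of_dvd {F k : Type*} [Field F] [Field k] [Algebra F k] {f : F[X]}
    {Q m r : ℕ} (h : InjOnFixed k f (Q ^ (m * r))) :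
    InjOnFixed k f (Q ^ m) := by
  have hpow (x : k) (hx : x ^ Q ^ m = x) : x ^ Q ^ (m * r) = x := by
    have h1 : ∀ r, x ^ Q ^ (m * r) = x := fun r => by
      induction r with
      | zero => simp
      | succ r ih => rw [mul_add, pow_add, pow_mul, ih, mul_one, hx]
    exact h1 r
  exact fun x y hx hy => h x y (hpow x hx) (hpow y hy)

variable {F : Type} [Field F] {k : Type*} [Field k] [Algebra F k] [IsAlgClosed k]

theorem mem_range_iff_pow_card_eq {E : Type*} [Field E] [Fintype E] (j : E →+* k) (x : k) :
    x ∈ Set.range j ↔ x ^ Fintype.card E = x := by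
  obtain ⟨p, hp⟩ := CharP.exists E
  obtain ⟨n, hpp, hn⟩ := FiniteField.card E p
  have : CharP k p := charP_of_injective_ringHom j.injective p
  have hQ : 1 < Fintype.card E := Fintype.one_lt_card
  have hsub : Set.range j ⊆ {x | x ^ Fintype.card E = x} := by
    rintro _ ⟨e, rfl⟩
    change j e ^ _ = j e
    rw [← map_pow, FiniteField.pow_card]
  have heq := Set.eq_of_subset_of_ncard_le hsub (by
    rw [ncard_pow_eq_self p hQ (hn ▸ dvd_pow_self p n.ne_zero), ← Nat.card_coe_set_eq,
      Nat.card_range_of_injective j.injective, Nat.card_eq_fintype_card])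
    (finite_pow_eq_self _ hQ)
  rw [heq]
  rfl

theorem bijective_aeval_iff_injOnFixed {E : Type*} [Field E] [Fintype E] [Algebra F E]
    (f : F[X]) : (Function.Bijective fun x : E => aeval x f) ↔
      InjOnFixed k f (Fintype.card E) := by
  have : Algebra.IsAlgebraic F E := Algebra.IsAlgebraic.of_finite F E
  let j : E →ₐ[F] k := IsAlgClosed.lift
  rw [← Finite.injective_iff_bijective]
  constructor
  · intro hinj x y hx hy hxy
    obtain ⟨u, rfl⟩ := (mem_range_iff_pow_card_eq (j : E →+* k) x).2 hx
    obtain ⟨v, rfl⟩ := (mem_range_iff_pow_card_eq (j : E →+* k) y).2 hy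
    simp only [AlgHom.coe_toRingHom, aeval_algHom_apply] at hxy ⊢
    exact congrArg j (hinj (j.injective hxy))
  · intro h u v huv
    refine j.injective (h (j u) (j v) ?_ ?_ ?_)
    · rw [← map_pow, FiniteField.pow_card]
    · rw [← map_pow, FiniteField.pow_card]
    · rw [aeval_algHom_apply, aeval_algHom_apply]
      exact congrArg j huv

theorem injOnFixed_expand_iff (p : ℕ) [Fact p.Prime] [CharP k p] (g : F[X]) (Q : ℕ) :
    InjOnFixed k (expand F p g) Q ↔ InjOnFixed k g Q := by
  have hp : p.Prime := Fact.out
  have hinj : Function.Injective fun x : k => x ^ p := frobenius_inj k p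
  constructor
  · intro h x y hx hy hxy
    obtain ⟨u, rfl⟩ := IsAlgClosed.exists_pow_nat_eq x hp.pos
    obtain ⟨v, rfl⟩ := IsAlgClosed.exists_pow_nat_eq y hp.pos
    rw [h u v (hinj (by simpa only [pow_right_comm] using hx))
      (hinj (by simpa only [pow_right_comm] using hy)) (by simpa only [expand_aeval] using hxy)]
  · intro h x y hx hy hxy
    rw [expand_aeval, expand_aeval] at hxy
    exact hinj (h _ _ (by rw [pow_right_comm, hx]) (by rw [pow_right_comm, hy]) hxy)

theorem exists_extension_card_eq (F : Type) [Field F] [Fintype F] {m : ℕ} (hm : 0 < m) :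
    ∃ (E : Type) (_ : Field E) (_ : Fintype E) (_ : Algebra F E),
      Fintype.card E = Fintype.card F ^ m := by
  obtain ⟨p, hp⟩ := CharP.exists F
  have := Fact.mk (CharP.char_is_prime F p)
  have : NeZero m := ⟨hm.ne'⟩
  let := Fintype.ofFinite (FiniteField.Extension F p m)
  refine ⟨FiniteField.Extension F p m, inferInstance, inferInstance, inferInstance, ?_⟩
  rw [← Nat.card_eq_fintype_card, FiniteField.natCard_extension, Nat.card_eq_fintype_card]

variable [Fintype F]

theorem forall_bijective_aeval_iff_injOnFixed (k : Type*) [Field k] [Algebra F k] [IsAlgClosed k]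
    (f : F[X]) {m : ℕ} (hm : 0 < m) :
    (∀ (E : Type) [Field E] [Fintype E] [Algebra F E], Fintype.card E = Fintype.card F ^ m →
      Function.Bijective fun x : E => aeval x f) ↔ InjOnFixed k f (Fintype.card F ^ m) := by
  constructor
  · intro h
    obtain ⟨E, _, _, _, hE⟩ := exists_extension_card_eq F hm
    rw [← hE]
    exact (bijective_aeval_iff_injOnFixed f).1 (h E hE)
  · intro h E _ _ _ hE
    rw [← hE] at h
    exact (bijective_aeval_iff_injOnFixed f).2 h

/-- If the collisions of `f` on a large finite field are concentrated on a small set, then `f` is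
injective there. -/
theorem injOnFixed_of_collision_mem {f : F[X]} (hf : f.natDegree ≠ 0) (B : Finset k) {M : ℕ}
    (hM : 0 < M) (hlarge : (B.card + 1) * f.natDegree < Fintype.card F ^ M - 1)
    (hB : ∀ x y : k, x ^ Fintype.card F ^ M = x → y ^ Fintype.card F ^ M = y →
      aeval x f = aeval y f → x ≠ y → x ∈ B) :
    InjOnFixed k f (Fintype.card F ^ M) := by
  classical
  obtain ⟨E, _, _, _, hE⟩ := exists_extension_card_eq F hM
  rw [← hE] at hlarge hB ⊢
  have : Algebra.IsAlgebraic F E := Algebra.IsAlgebraic.of_finite F E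
  let j : E →ₐ[F] k := IsAlgClosed.lift
  refine (bijective_aeval_iff_injOnFixed f).1 ?_
  rw [← Finite.surjective_iff_bijective]
  by_contra hs
  let g := f.map (algebraMap F E)
  have hg : (fun x : E => aeval x f) = fun x => g.eval x := by
    ext x; simp [g, eval_map_algebraMap]
  rw [hg] at hs
  have hgd : g.natDegree = f.natDegree := natDegree_map _
  have h1 := card_image_eval_add_lt (f := g) (by rwa [hgd]) (by rwa [hgd]) hs
  let A : Finset E := Finset.univ.filter fun u => j u ∉ B
  have hinj : Set.InjOn (fun u => g.eval u) A := by
    intro u hu v _ huv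
    by_contra hne
    refine (Finset.mem_filter.1 hu).2 (hB (j u) (j v) ?_ ?_ ?_ (j.injective.ne hne))
    · rw [← map_pow, FiniteField.pow_card]
    · rw [← map_pow, FiniteField.pow_card]
    · rw [aeval_algHom_apply, aeval_algHom_apply]
      exact congrArg j (by simpa [g, eval_map_algebraMap] using huv)
  have h2 : A.card ≤ (Finset.univ.image fun u => g.eval u).card := by
    rw [← Finset.card_image_of_injOn hinj]
    exact Finset.card_le_card (Finset.image_subset_image (Finset.filter_subset _ _))
  have h3 : (Finset.univ.filter fun u : E => ¬ j u ∉ B).card ≤ B.card :=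
    Finset.card_le_card_of_injOn j (fun u hu => by simpa using hu) j.injective.injOn
  have h4 := Finset.card_filter_add_card_filter_not (s := (Finset.univ : Finset E))
    (fun u => j u ∉ B)
  rw [Finset.card_univ] at h4
  change A.card + _ = _ at h4
  omega

theorem exists_coprime_injOnFixed_of_derivative_ne_zero {f : F[X]} (hf' : derivative f ≠ 0)
    (hS : {m : ℕ | 0 < m ∧ InjOnFixed k f (Fintype.card F ^ m)}.Infinite) :
    ∃ N, 0 < N ∧ ∀ m, 0 < m → m.Coprime N → InjOnFixed k f (Fintype.card F ^ m) := by
  obtain ⟨p, hp⟩ := CharP.exists F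
  obtain ⟨a, hpp, ha⟩ := FiniteField.card F p
  have := Fact.mk hpp
  have : CharP k p := charP_of_injective_algebraMap (algebraMap F k).injective p
  have hfd : f.natDegree ≠ 0 := fun h => hf' (by
    rw [natDegree_eq_zero.1 h |>.choose_spec.symm, derivative_C])
  let σ : k ≃+* k := iterateFrobeniusEquiv k p a
  have hσ1 (x : k) : σ x = x ^ p ^ (a : ℕ) := iterateFrobeniusEquiv_def k p a x
  have hσ (m : ℕ) (x : k) : σ^[m] x = x ^ p ^ ((a : ℕ) * m) := by
    induction m with
    | zero => simp
    | succ m ih => rw [Function.iterate_succ_apply', ih, hσ1, ← pow_mul, ← pow_add, mul_add,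
        mul_one]
  have hQ (m : ℕ) : Fintype.card F ^ m = p ^ ((a : ℕ) * m) := by rw [ha, pow_mul]
  have hcoll (m : ℕ) : InjOnFixed k f (Fintype.card F ^ m) ↔ ∀ x y : k,
      x ^ p ^ ((a : ℕ) * m) = x → y ^ p ^ ((a : ℕ) * m) = y →
      (f.map (algebraMap F k)).eval x = (f.map (algebraMap F k)).eval y → x = y := by
    simp only [InjOnFixed, hQ, eval_map_algebraMap]
  have hfσ : (f.map (algebraMap F k)).map (σ : k →+* k) = f.map (algebraMap F k) := by
    rw [map_map]
    congr 1
    ext c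
    change σ (algebraMap F k c) = _
    rw [hσ1, ← map_pow, ← ha, FiniteField.pow_card]
  have hfk' : derivative (f.map (algebraMap F k)) ≠ 0 := by
    rwa [derivative_map, Ne, Polynomial.map_eq_zero]
  simp only [hcoll] at hS
  obtain ⟨N, hN, B, hB⟩ := exists_finset_forall_collision_mem p a.ne_zero σ hσ hfσ hfk' hS
  refine ⟨N, hN, fun m hm hmN => ?_⟩
  set K := (B.card + 1) * f.natDegree + 1 with hK
  have hr : (m * (1 + N * K)).Coprime N :=
    Nat.Coprime.mul_left hmN (by simp)
  refine InjOnFixed.of_dvd (r := 1 + N * K)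
    (injOnFixed_of_collision_mem hfd B (by positivity) ?_ ?_)
  · have h1 : m * (1 + N * K) < Fintype.card F ^ (m * (1 + N * K)) :=
      Nat.lt_pow_self Fintype.one_lt_card
    have h2 : K < m * (1 + N * K) :=
      calc K ≤ N * K := Nat.le_mul_of_pos_left K hN
        _ < 1 + N * K := by omega
        _ ≤ m * (1 + N * K) := Nat.le_mul_of_pos_left _ hm
    omega
  · intro x y hx hy hxy
    rw [hQ] at hx hy
    refine hB _ hr x y hx hy ?_
    simpa only [eval_map_algebraMap] using hxy

theorem exists_coprime_injOnFixed (f : F[X])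
    (hS : {m : ℕ | 0 < m ∧ InjOnFixed k f (Fintype.card F ^ m)}.Infinite) :
    ∃ N, 0 < N ∧ ∀ m, 0 < m → m.Coprime N → InjOnFixed k f (Fintype.card F ^ m) := by
  obtain ⟨p, hp⟩ := CharP.exists F
  have hpp := CharP.char_is_prime F p
  have := Fact.mk hpp
  have : CharP k p := charP_of_injective_algebraMap (algebraMap F k).injective p
  induction hn : f.natDegree using Nat.strong_induction_on generalizing f with
  | _ n ih =>
    by_cases hf' : derivative f = 0
    · have hexp := expand_contract p hf' hpp.ne_zero
      have hdeg : (contract p f).natDegree * p = n := by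
        rw [← natDegree_expand, hexp, hn]
      rcases Nat.eq_zero_or_pos n with rfl | hpos
      · obtain ⟨c, rfl⟩ := natDegree_eq_zero.1 hn
        obtain ⟨m, hm, h⟩ := hS.nonempty
        refine absurd (h 0 1 (zero_pow (pow_ne_zero _ Fintype.card_ne_zero)) (one_pow _) ?_)
          zero_ne_one
        simp
      · have hlt : (contract p f).natDegree < n := by
          nlinarith [hpp.two_le]
        rw [← hexp] at hS ⊢
        simp only [injOnFixed_expand_iff] at hS ⊢
        exact ih _ hlt _ hS rfl
    · exact exists_coprime_injOnFixed_of_derivative_ne_zero hf' hS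

end Permutation

theorem statement14 (F : Type) [Field F] [Fintype F] (f : Polynomial F) :
    {m : ℕ | 0 < m ∧ ∀ (E : Type) [Field E] [Fintype E] [Algebra F E],
        Fintype.card E = Fintype.card F ^ m →
        Function.Bijective fun x : E => Polynomial.aeval x f}.Infinite ↔
      ∃ N : ℕ, 0 < N ∧ ∀ m : ℕ, 0 < m → Nat.Coprime m N →
        ∀ (E : Type) [Field E] [Fintype E] [Algebra F E],
          Fintype.card E = Fintype.card F ^ m →
          Function.Bijective fun x : E => Polynomial.aeval x f := by
  constructor
  · intro hS
    obtain ⟨N, hN, h⟩ := exists_coprime_injOnFixed (k := AlgebraicClosure F) f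
      (hS.mono fun m hm => ⟨hm.1, (forall_bijective_aeval_iff_injOnFixed _ f hm.1).1 hm.2⟩)
    exact ⟨N, hN, fun m hm hmN =>
      (forall_bijective_aeval_iff_injOnFixed (AlgebraicClosure F) f hm).2 (h m hm hmN)⟩
  · rintro ⟨N, hN, h⟩
    refine Set.infinite_of_injective_forall_mem (f := fun j : ℕ => 1 + N * j)
      (fun i j hij => ?_) fun j => ⟨by positivity, h _ (by positivity) (by simp)⟩
    exact Nat.eq_of_mul_eq_mul_left hN (Nat.add_left_cancel hij)
end
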